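/- arXiv:2101.12158 — 10 statements merged into one kernel-verified Lean document; each statement's English description precedes it below -/
import Mathlib

section
/- There exists an absolute constant C such that for all finite sets A, B of real numbers with |A| + |B| = n ≥ 2, the relation R = {(a,b) ∈ A × B : a < b} admits an exact rectangle partition with at most n rectangles and weight at most C · n · (1 + log₂ n). -/
/-- An exact rectangle partition of the relation `R` restricted to `A × B`:
a finite family of rectangles `S i × T i` with `S i ⊆ A`, `T i ⊆ B`, every rectangle
contained in `R`, and every pair of `R` (within `A × B`) covered by exactly one rectangle. -/
def IsExactRectPartition {α β : Type*} (A : Finset α) (B : Finset β)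
    (R : α → β → Prop) (m : ℕ) (S : Fin m → Finset α) (T : Fin m → Finset β) : Prop :=
  (∀ i, S i ⊆ A) ∧ (∀ i, T i ⊆ B) ∧
  (∀ i, ∀ a ∈ S i, ∀ b ∈ T i, R a b) ∧
  (∀ a ∈ A, ∀ b ∈ B, R a b → ∃! i, a ∈ S i ∧ b ∈ T i)

/-- A finite set in a linear order has an initial segment of every size up to its own. -/
theorem exists_initial_subset_card_eq {α : Type*} [LinearOrder α] (U : Finset α) (k : ℕ)
    (hk : k ≤ U.card) :
    ∃ L ⊆ U, L.card = k ∧ ∀ x ∈ L, ∀ y ∈ U, y ∉ L → x < y := by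
  induction k with
  | zero => exact ⟨∅, by simp⟩
  | succ k ih =>
    obtain ⟨L, hLU, hL, hlt⟩ := ih (by omega)
    have hne : (U \ L).Nonempty := by
      rw [← Finset.card_pos, Finset.card_sdiff_of_subset hLU]
      omega
    obtain ⟨hzU, hzL⟩ := Finset.mem_sdiff.1 ((U \ L).min'_mem hne)
    refine ⟨insert ((U \ L).min' hne) L, Finset.insert_subset hzU hLU, ?_, ?_⟩
    · rw [Finset.card_insert_of_notMem hzL, hL]
    · intro x hx y hy hyL
      rw [Finset.mem_insert, not_or] at hyL
      rcases Finset.mem_insert.1 hx with rfl | hx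
      · exact lt_of_le_of_ne
          (Finset.min'_le _ _ (Finset.mem_sdiff.2 ⟨hy, hyL.2⟩)) (Ne.symm hyL.1)
      · exact hlt x hx y hy hyL.2

/-- Binary partitioning: if the values of `A` and `B` lie in a set of at most `2 ^ d` elements,
the strict order on `A × B` splits into rectangles of total weight at most
`d * (A.card + B.card)`. -/
theorem exists_rect_partition_lt {α : Type*} [LinearOrder α] (d : ℕ) (U A B : Finset α)
    (hU : U.card ≤ 2 ^ d) (hA : A ⊆ U) (hB : B ⊆ U) :
    ∃ (ι : Type) (_ : Fintype ι) (S T : ι → Finset α),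
      (∀ i, S i ⊆ A) ∧ (∀ i, T i ⊆ B) ∧ (∀ i, ∀ a ∈ S i, ∀ b ∈ T i, a < b) ∧
      (∀ a ∈ A, ∀ b ∈ B, a < b → ∃! i, a ∈ S i ∧ b ∈ T i) ∧
      Fintype.card ι ≤ U.card - 1 ∧
      ∑ i, ((S i).card + (T i).card) ≤ d * (A.card + B.card) := by
  induction d generalizing U A B with
  | zero =>
    refine ⟨Empty, inferInstance, Empty.elim, Empty.elim, by simp, by simp, by simp, ?_,
      by simp, by simp⟩
    intro a ha b hb hab
    exact absurd (Finset.card_le_one.1 (by simpa using hU) a (hA ha) b (hB hb)) hab.ne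
  | succ d ih =>
    by_cases hd : U.card ≤ 2 ^ d
    · obtain ⟨ι, hι, S, T, h1, h2, h3, h4, h5, h6⟩ := ih U A B hd hA hB
      exact ⟨ι, hι, S, T, h1, h2, h3, h4, h5, h6.trans (by gcongr; omega)⟩
    · obtain ⟨L, hLU, hL, hlt⟩ := exists_initial_subset_card_eq U (2 ^ d) (by omega)
      have hsd := Finset.card_sdiff_of_subset hLU
      have hpos : 0 < 2 ^ d := by positivity
      rw [pow_succ] at hU
      obtain ⟨ι, _, S, T, h1, h2, h3, h4, h5, h6⟩ := ih L (A ∩ L) (B ∩ L) hL.le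
        Finset.inter_subset_right Finset.inter_subset_right
      obtain ⟨κ, _, P, Q, k1, k2, k3, k4, k5, k6⟩ := ih (U \ L) (A \ L) (B \ L) (by omega)
        (Finset.sdiff_subset_sdiff hA le_rfl) (Finset.sdiff_subset_sdiff hB le_rfl)
      have hcA := Finset.card_inter_add_card_sdiff A L
      have hcB := Finset.card_inter_add_card_sdiff B L
      have memS : ∀ i a, a ∈ S i → a ∈ A ∧ a ∈ L := fun i a h => Finset.mem_inter.1 (h1 i h)
      have memT : ∀ i b, b ∈ T i → b ∈ B ∧ b ∈ L := fun i b h => Finset.mem_inter.1 (h2 i h)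
      have memP : ∀ i a, a ∈ P i → a ∈ A ∧ a ∉ L := fun i a h => Finset.mem_sdiff.1 (k1 i h)
      have memQ : ∀ i b, b ∈ Q i → b ∈ B ∧ b ∉ L := fun i b h => Finset.mem_sdiff.1 (k2 i h)
      refine ⟨Option (ι ⊕ κ), inferInstance, fun o => o.elim (A ∩ L) (Sum.elim S P),
        fun o => o.elim (B \ L) (Sum.elim T Q), ?_, ?_, ?_, ?_, ?_, ?_⟩
      · rintro (_ | i | i) a ha
        · exact (Finset.mem_inter.1 ha).1
        · exact (memS i a ha).1
        · exact (memP i a ha).1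
      · rintro (_ | i | i) b hb
        · exact (Finset.mem_sdiff.1 hb).1
        · exact (memT i b hb).1
        · exact (memQ i b hb).1
      · rintro (_ | i | i) a ha b hb
        · obtain ⟨hbB, hbL⟩ := Finset.mem_sdiff.1 hb
          exact hlt a (Finset.mem_inter.1 ha).2 b (hB hbB) hbL
        · exact h3 i a ha b hb
        · exact k3 i a ha b hb
      · intro a ha b hb hab
        by_cases haL : a ∈ L
        · by_cases hbL : b ∈ L
          · obtain ⟨i, hi, hu⟩ := h4 a (Finset.mem_inter.2 ⟨ha, haL⟩) b
              (Finset.mem_inter.2 ⟨hb, hbL⟩) hab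
            refine ⟨some (Sum.inl i), hi, ?_⟩
            rintro (_ | j | j) ⟨hja, hjb⟩
            · exact absurd hbL (Finset.mem_sdiff.1 hjb).2
            · rw [hu j ⟨hja, hjb⟩]
            · exact absurd haL (memP j a hja).2
          · refine ⟨none, ⟨Finset.mem_inter.2 ⟨ha, haL⟩, Finset.mem_sdiff.2 ⟨hb, hbL⟩⟩, ?_⟩
            rintro (_ | j | j) ⟨hja, hjb⟩
            · rfl
            · exact absurd (memT j b hjb).2 hbL
            · exact absurd haL (memP j a hja).2
        · have hbL : b ∉ L := fun hbL => lt_asymm hab (hlt b hbL a (hA ha) haL)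
          obtain ⟨i, hi, hu⟩ := k4 a (Finset.mem_sdiff.2 ⟨ha, haL⟩) b
            (Finset.mem_sdiff.2 ⟨hb, hbL⟩) hab
          refine ⟨some (Sum.inr i), hi, ?_⟩
          rintro (_ | j | j) ⟨hja, hjb⟩
          · exact absurd (Finset.mem_inter.1 hja).2 haL
          · exact absurd (memS j a hja).2 haL
          · rw [hu j ⟨hja, hjb⟩]
      · rw [Fintype.card_option, Fintype.card_sum]
        omega
      · rw [Fintype.sum_option, Fintype.sum_sum_type]
        simp only [Option.elim_none, Option.elim_some, Sum.elim_inl, Sum.elim_inr]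
        calc _ ≤ ((A ∩ L).card + (B \ L).card) + (d * ((A ∩ L).card + (B ∩ L).card)
              + d * ((A \ L).card + (B \ L).card)) := by gcongr
          _ = ((A ∩ L).card + (B \ L).card) + d * (A.card + B.card) := by
            rw [← hcA, ← hcB]; ring
          _ ≤ (A.card + B.card) + d * (A.card + B.card) := by
            gcongr
            · exact Finset.inter_subset_left
            · exact Finset.sdiff_subset
          _ = (d + 1) * (A.card + B.card) := by ring

/-- Binary partitioning for a single strict inequality: for `A, B ⊆ ℝ` with `|A| + |B| = n ≥ 2`,
the relation `{(a,b) : a < b}` has an exact rectangle partition with at most `n` rectangles and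
weight at most `C · n · (1 + log₂ n)`. -/
theorem strict_inequality_rect_partition :
    ∃ C : ℝ, ∀ (A B : Finset ℝ) (n : ℕ), A.card + B.card = n → 2 ≤ n →
      ∃ (m : ℕ) (S : Fin m → Finset ℝ) (T : Fin m → Finset ℝ),
        IsExactRectPartition A B (fun a b => a < b) m S T ∧
        m ≤ n ∧
        (∑ i, (((S i).card : ℝ) + ((T i).card : ℝ))) ≤ C * n * (1 + Real.logb 2 n) := by
  refine ⟨1, fun A B n hn hn2 => ?_⟩
  have hU : (A ∪ B).card ≤ n := hn ▸ Finset.card_union_le A B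
  obtain ⟨ι, _, S, T, h1, h2, h3, h4, h5, h6⟩ :=
    exists_rect_partition_lt (Nat.log 2 n + 1) (A ∪ B) A B
      (hU.trans (Nat.lt_pow_succ_log_self one_lt_two n).le)
      Finset.subset_union_left Finset.subset_union_right
  let e := (Fintype.equivFin ι).symm
  refine ⟨Fintype.card ι, S ∘ e, T ∘ e, ⟨fun i => h1 _, fun i => h2 _, fun i => h3 _, ?_⟩,
    by omega, ?_⟩
  · intro a ha b hb hab
    obtain ⟨i, hi, hu⟩ := h4 a ha b hb hab
    refine ⟨e.symm i, by simpa using hi, fun j hj => ?_⟩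
    rw [← hu (e j) hj, e.symm_apply_apply]
  · have hsum : ∑ i, ((((S ∘ e) i).card : ℝ) + (((T ∘ e) i).card : ℝ)) =
        ∑ i, (((S i).card : ℝ) + ((T i).card : ℝ)) :=
      e.sum_comp fun i => ((S i).card : ℝ) + ((T i).card : ℝ)
    have hweight : ∑ i, (((S i).card : ℝ) + ((T i).card : ℝ)) ≤ ((Nat.log 2 n : ℝ) + 1) * n := by
      rw [hn] at h6
      exact_mod_cast h6
    have hlog : (Nat.log 2 n : ℝ) ≤ Real.logb 2 n := by
      exact_mod_cast Real.natLog_le_logb n 2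
    rw [hsum]
    calc _ ≤ ((Nat.log 2 n : ℝ) + 1) * n := hweight
      _ ≤ (Real.logb 2 n + 1) * n := by gcongr
      _ = 1 * n * (1 + Real.logb 2 n) := by ring
end

section
/- For every p ≥ 1 and q ≥ 0 there exists a constant C (depending only on p and q) such that for all finite sets A, B ⊆ ℝ^{p+q} with |A| + |B| = n ≥ 2, the relation R = {(a,b) ∈ A × B : a_j < b_j for all j ∈ {1,…,p} and a_{p+j} = b_{p+j} for all j ∈ {1,…,q}} admits an exact rectangle partition of weight at most C · n · (1 + log₂ n)^p. -/
theorem Nat.lt_of_testBit_split {x y k : ℕ} (hx : x / 2 ^ k % 2 = 0) (hy : y / 2 ^ k % 2 = 1)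
    (h : x / 2 ^ (k + 1) = y / 2 ^ (k + 1)) : x < y := by
  rw [pow_succ, ← Nat.div_div_eq_div_mul, ← Nat.div_div_eq_div_mul] at h
  by_contra! hle
  have := Nat.div_le_div_right (c := 2 ^ k) hle
  omega

theorem Nat.exists_testBit_split {K : ℕ} : ∀ {x y : ℕ}, x < y → y < 2 ^ K →
    ∃ k < K, x / 2 ^ k % 2 = 0 ∧ y / 2 ^ k % 2 = 1 ∧ x / 2 ^ (k + 1) = y / 2 ^ (k + 1) := by
  induction K with
  | zero => intro x y hxy hy; omega
  | succ K ih =>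
    intro x y hxy hy
    by_cases h : x / 2 < y / 2
    · obtain ⟨k, hk, h₁, h₂, h₃⟩ := ih h (by rw [pow_succ] at hy; omega)
      simp only [Nat.div_div_eq_div_mul, ← pow_succ'] at h₁ h₂ h₃
      exact ⟨k + 1, by omega, h₁, h₂, h₃⟩
    · refine ⟨0, by omega, ?_⟩
      simp only [pow_zero, zero_add, pow_one, Nat.div_one]
      omega

theorem Nat.testBit_split_unique {x y k l : ℕ}
    (hkx : x / 2 ^ k % 2 = 0) (hky : y / 2 ^ k % 2 = 1) (hk : x / 2 ^ (k + 1) = y / 2 ^ (k + 1))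
    (hlx : x / 2 ^ l % 2 = 0) (hly : y / 2 ^ l % 2 = 1) (hl : x / 2 ^ (l + 1) = y / 2 ^ (l + 1)) :
    k = l := by
  have key : ∀ {i j : ℕ}, i < j → x / 2 ^ (i + 1) = y / 2 ^ (i + 1) →
      x / 2 ^ j = y / 2 ^ j := by
    intro i j hij h
    obtain ⟨d, rfl⟩ := Nat.exists_eq_add_of_lt hij
    rw [show i + d + 1 = i + 1 + d by ring, pow_add, ← Nat.div_div_eq_div_mul,
      ← Nat.div_div_eq_div_mul, h]
  rcases lt_trichotomy k l with h | h | h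
  · have := key h hk
    omega
  · exact h
  · have := key h hl
    omega

/-- If `R` is the disjoint union over `l : L` of the relations `P l a ∧ Q l b ∧ f l a = g l b`,
then it has an exact rectangle partition of weight at most `|L| * (|A| + |B|)`. -/
theorem exists_isExactRectPartition_of_keys {α β L κ : Type*} [Fintype L]
    (A : Finset α) (B : Finset β) (R : α → β → Prop) (P : L → α → Prop) (Q : L → β → Prop)
    (f : L → α → κ) (g : L → β → κ)
    (hR : ∀ l, ∀ a ∈ A, ∀ b ∈ B, P l a → Q l b → f l a = g l b → R a b)
    (hu : ∀ a ∈ A, ∀ b ∈ B, R a b → ∃! l, P l a ∧ Q l b ∧ f l a = g l b) :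
    ∃ (m : ℕ) (S : Fin m → Finset α) (T : Fin m → Finset β), IsExactRectPartition A B R m S T ∧
      ∑ i, ((S i).card + (T i).card) ≤ Fintype.card L * (A.card + B.card) := by
  classical
  let Z : Finset κ := Finset.univ.biUnion fun l => A.image (f l)
  let e := Fintype.equivFin (L × Z)
  let S : L × Z → Finset α := fun i => {a ∈ A | P i.1 a ∧ f i.1 a = i.2}
  let T : L × Z → Finset β := fun i => {b ∈ B | Q i.1 b ∧ g i.1 b = i.2}
  refine ⟨Fintype.card (L × Z), fun i => S (e.symm i), fun i => T (e.symm i),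
    ⟨fun i => Finset.filter_subset _ _, fun i => Finset.filter_subset _ _, ?_, ?_⟩, ?_⟩
  · intro i a ha b hb
    obtain ⟨ha, hP, hf⟩ := Finset.mem_filter.1 ha
    obtain ⟨hb, hQ, hg⟩ := Finset.mem_filter.1 hb
    exact hR _ a ha b hb hP hQ (hf.trans hg.symm)
  · intro a ha b hb hab
    obtain ⟨l, ⟨hP, hQ, hfg⟩, hl⟩ := hu a ha b hb hab
    have hz : f l a ∈ Z :=
      Finset.mem_biUnion.2 ⟨l, Finset.mem_univ l, Finset.mem_image_of_mem _ ha⟩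
    refine ⟨e (l, ⟨f l a, hz⟩), ?_, ?_⟩
    · simp [S, T, ha, hb, hP, hQ, hfg]
    · rintro i ⟨hS, hT⟩
      obtain ⟨-, hP', hf⟩ := Finset.mem_filter.1 hS
      obtain ⟨-, hQ', hg⟩ := Finset.mem_filter.1 hT
      have h₁ := hl _ ⟨hP', hQ', hf.trans hg.symm⟩
      rw [← e.symm_apply_eq]
      refine Prod.ext h₁ (Subtype.ext ?_)
      rw [← hf, h₁]
  · rw [e.symm.sum_comp fun i => (S i).card + (T i).card, Fintype.sum_prod_type, ← smul_eq_mul,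
      ← Finset.card_univ]
    refine Finset.sum_le_card_nsmul _ _ _ fun l _ => ?_
    rw [Finset.sum_add_distrib]
    gcongr
    · rw [← Finset.card_biUnion]
      · exact Finset.card_le_card (Finset.biUnion_subset.2 fun z _ => Finset.filter_subset _ _)
      · intro z _ w _ hzw
        refine Finset.disjoint_left.2 fun a h h' => hzw (Subtype.ext ?_)
        exact (Finset.mem_filter.1 h).2.2.symm.trans (Finset.mem_filter.1 h').2.2
    · rw [← Finset.card_biUnion]
      · exact Finset.card_le_card (Finset.biUnion_subset.2 fun z _ => Finset.filter_subset _ _)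
      · intro z _ w _ hzw
        refine Finset.disjoint_left.2 fun a h h' => hzw (Subtype.ext ?_)
        exact (Finset.mem_filter.1 h).2.2.symm.trans (Finset.mem_filter.1 h').2.2

theorem Nat.clog_two_le_one_add_logb {n : ℕ} (hn : 2 ≤ n) :
    (Nat.clog 2 n : ℝ) ≤ 1 + Real.logb 2 n := by
  have h := Nat.pow_pred_clog_lt_self (b := 2) one_lt_two hn
  have hpos := Nat.clog_pos one_lt_two hn
  have h' : ((Nat.clog 2 n - 1 : ℕ) : ℝ) ≤ Real.logb 2 n := by
    rw [Real.le_logb_iff_rpow_le one_lt_two (by positivity), Real.rpow_natCast]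
    exact_mod_cast h.le
  rw [Nat.cast_sub hpos] at h'
  push_cast at h'
  linarith

/-- Conjunction of `p` strict inequalities and `q` equalities: for
`A, B ⊆ ℝ^(p+q)` with `|A| + |B| = n ≥ 2`, the relation requiring `a_j < b_j` on the first `p`
coordinates and `a_j = b_j` on the remaining `q` coordinates admits an exact rectangle
partition of weight at most `C · n · (1 + log₂ n)^p`, where `C` depends only on `p` and `q`. -/
theorem conjunction_rect_partition :
    ∀ p q : ℕ, 1 ≤ p → ∃ C : ℝ,
      ∀ (A B : Finset (Fin (p + q) → ℝ)) (n : ℕ), A.card + B.card = n → 2 ≤ n →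
        ∃ (m : ℕ) (S : Fin m → Finset (Fin (p + q) → ℝ)) (T : Fin m → Finset (Fin (p + q) → ℝ)),
          IsExactRectPartition A B
            (fun a b => ∀ j : Fin (p + q),
              ((j : ℕ) < p → a j < b j) ∧ (p ≤ (j : ℕ) → a j = b j)) m S T ∧
          (∑ i, (((S i).card : ℝ) + ((T i).card : ℝ))) ≤ C * n * (1 + Real.logb 2 n) ^ p := by
  intro p q _
  refine ⟨1, fun A B n hn h2 => ?_⟩
  let rk : Fin p → ℝ → ℕ := fun j t => {a ∈ A | a (Fin.castAdd q j) < t}.card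
  have hrk_mono : ∀ j, Monotone (rk j) := fun j s t hst =>
    Finset.card_le_card (Finset.monotone_filter_right _ fun a _ h => lt_of_lt_of_le h hst)
  have hrk_lt : ∀ j, ∀ a ∈ A, ∀ t, a (Fin.castAdd q j) < t →
      rk j (a (Fin.castAdd q j)) < rk j t := by
    intro j a ha t hat
    refine Finset.card_lt_card (Finset.ssubset_iff_of_subset
      (Finset.monotone_filter_right _ fun c _ h => lt_trans h hat) |>.2 ⟨a, ?_, ?_⟩)
    · simp [ha, hat]
    · simp
  have hrk_bound : B.Nonempty → ∀ j t, rk j t < 2 ^ Nat.clog 2 n := fun hB j t =>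
    calc rk j t ≤ A.card := Finset.card_filter_le _ _
      _ < n := by have := hB.card_pos; omega
      _ ≤ 2 ^ Nat.clog 2 n := Nat.le_pow_clog one_lt_two n
  have hkeys := exists_isExactRectPartition_of_keys
    (L := Fin p → Fin (Nat.clog 2 n)) (κ := (Fin p → ℕ) × (Fin q → ℝ)) A B
    (fun a b => ∀ j : Fin (p + q), ((j : ℕ) < p → a j < b j) ∧ (p ≤ (j : ℕ) → a j = b j))
    (fun l a => ∀ j, rk j (a (Fin.castAdd q j)) / 2 ^ (l j : ℕ) % 2 = 0)
    (fun l b => ∀ j, rk j (b (Fin.castAdd q j)) / 2 ^ (l j : ℕ) % 2 = 1)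
    (fun l a => (fun j => rk j (a (Fin.castAdd q j)) / 2 ^ ((l j : ℕ) + 1),
      fun j => a (Fin.natAdd p j)))
    (fun l b => (fun j => rk j (b (Fin.castAdd q j)) / 2 ^ ((l j : ℕ) + 1),
      fun j => b (Fin.natAdd p j)))
    ?_ ?_
  · obtain ⟨m, S, T, hST, hw⟩ := hkeys
    refine ⟨m, S, T, hST, ?_⟩
    rw [Fintype.card_fun, Fintype.card_fin, Fintype.card_fin, hn] at hw
    calc ∑ i, (((S i).card : ℝ) + ((T i).card : ℝ))
        ≤ (Nat.clog 2 n : ℝ) ^ p * n := by exact_mod_cast hw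
      _ ≤ (1 + Real.logb 2 n) ^ p * n := by
        gcongr
        exact Nat.clog_two_le_one_add_logb h2
      _ = 1 * n * (1 + Real.logb 2 n) ^ p := by ring
  · intro l a _ b _ hP hQ hfg j
    obtain ⟨h₁, h₂⟩ := Prod.mk.inj hfg
    induction j using Fin.addCases with
    | left j =>
      refine ⟨fun _ => ?_, fun h => absurd h (by simp)⟩
      exact (hrk_mono j).reflect_lt (Nat.lt_of_testBit_split (hP j) (hQ j) (congrFun h₁ j))
    | right j => exact ⟨fun h => absurd h (by simp), fun _ => congrFun h₂ j⟩
  · intro a ha b hb hab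
    choose l hl hx hy hxy using fun j : Fin p => Nat.exists_testBit_split
      (hrk_lt j a ha _ ((hab (Fin.castAdd q j)).1 (by simp)))
      (hrk_bound ⟨b, hb⟩ j (b (Fin.castAdd q j)))
    refine ⟨fun j => ⟨l j, hl j⟩, ⟨hx, hy, Prod.ext (funext hxy) (funext fun j =>
      (hab (Fin.natAdd p j)).2 (by simp))⟩, ?_⟩
    rintro l' ⟨hP, hQ, hfg⟩
    exact funext fun j => Fin.ext (Nat.testBit_split_unique (hP j) (hQ j)
      (congrFun (Prod.mk.inj hfg).1 j) (hx j) (hy j) (hxy j))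
end

section
/- Let f : ℕ → ℝ≥0 be superadditive, i.e., f(m) + f(m') ≤ f(m + m') for all m, m'. Let A, B be finite sets, K a set, κ_A : A → K and κ_B : B → K key functions, and R ⊆ A × B a relation such that (a,b) ∈ R implies κ_A(a) = κ_B(b). For k ∈ K write A_k = κ_A^{-1}(k), B_k = κ_B^{-1}(k), and R_k = R ∩ (A_k × B_k). If for every k ∈ K the relation R_k admits an exact rectangle partition of weight at most f(|A_k| + |B_k|), then R admits an exact rectangle partition of weight at most f(|A| + |B|). -/
/-- A superadditive function dominates finite sums of its values. -/
theorem sum_le_apply_sum_of_superadditive {ι : Type*} (f : ℕ → NNReal)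
    (hf : ∀ m m' : ℕ, f m + f m' ≤ f (m + m')) (s : Finset ι) (n : ι → ℕ) :
    ∑ i ∈ s, f (n i) ≤ f (∑ i ∈ s, n i) := by
  classical
  induction s using Finset.induction_on with
  | empty => simp
  | insert a s ha ih =>
    rw [Finset.sum_insert ha, Finset.sum_insert ha]
    exact (add_le_add_right ih _).trans (hf _ _)

/-- Reducing a relation refining a key-equality to its per-key classes: if `f` is superadditive
and each class relation `R_k = R ∩ (A_k × B_k)` has an exact rectangle partition of weight at most
`f (|A_k| + |B_k|)`, then `R` has an exact rectangle partition of weight at most `f (|A| + |B|)`. -/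
theorem rect_partition_of_key_classes {α β K : Type*} [DecidableEq K]
    (f : ℕ → NNReal) (hf : ∀ m m' : ℕ, f m + f m' ≤ f (m + m'))
    (A : Finset α) (B : Finset β) (κA : α → K) (κB : β → K)
    (R : α → β → Prop)
    (hR : ∀ a ∈ A, ∀ b ∈ B, R a b → κA a = κB b)
    (h : ∀ k : K,
      ∃ (m : ℕ) (S : Fin m → Finset α) (T : Fin m → Finset β),
        IsExactRectPartition (A.filter fun a => κA a = k) (B.filter fun b => κB b = k)
          R m S T ∧
        (∑ i, (((S i).card : NNReal) + ((T i).card : NNReal))) ≤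
          f ((A.filter fun a => κA a = k).card + (B.filter fun b => κB b = k).card)) :
    ∃ (m : ℕ) (S : Fin m → Finset α) (T : Fin m → Finset β),
      IsExactRectPartition A B R m S T ∧
      (∑ i, (((S i).card : NNReal) + ((T i).card : NNReal))) ≤ f (A.card + B.card) := by
  classical
  choose m S T hP hw using h
  let s : Finset K := A.image κA ∪ B.image κB
  let e := Fintype.equivFin (Σ k : s, Fin (m k))
  have hA : ∀ k i, ∀ a ∈ S k i, a ∈ A ∧ κA a = k := fun k i a ha =>
    Finset.mem_filter.1 ((hP k).1 i ha)
  have hB : ∀ k i, ∀ b ∈ T k i, b ∈ B ∧ κB b = k := fun k i b hb =>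
    Finset.mem_filter.1 ((hP k).2.1 i hb)
  refine ⟨_, fun j => S (e.symm j).1 (e.symm j).2, fun j => T (e.symm j).1 (e.symm j).2,
    ⟨fun j a ha => (hA _ _ a ha).1, fun j b hb => (hB _ _ b hb).1,
      fun j => (hP _).2.2.1 _, fun a ha b hb hab => ?_⟩, ?_⟩
  · have hs : κA a ∈ s := Finset.mem_union_left _ (Finset.mem_image_of_mem _ ha)
    obtain ⟨i, hi, hu⟩ := (hP (κA a)).2.2.2 a (Finset.mem_filter.2 ⟨ha, rfl⟩) b
      (Finset.mem_filter.2 ⟨hb, (hR a ha b hb hab).symm⟩) hab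
    have huniq : ∀ p : Σ k : s, Fin (m k), a ∈ S p.1 p.2 ∧ b ∈ T p.1 p.2 →
        p = ⟨⟨κA a, hs⟩, i⟩ := by
      rintro ⟨⟨k, hk⟩, i'⟩ hp
      obtain rfl : κA a = k := (hA _ _ a hp.1).2
      rw [hu i' hp]
    refine ⟨e ⟨⟨κA a, hs⟩, i⟩, ?_, fun j hj => e.symm_apply_eq.1 (huniq _ hj)⟩
    beta_reduce
    rw [e.symm_apply_apply]
    exact hi
  · have hcA : A.card = ∑ k ∈ s, (A.filter fun a => κA a = k).card :=
      Finset.card_eq_sum_card_fiberwise fun a ha =>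
        Finset.mem_union_left _ (Finset.mem_image_of_mem _ ha)
    have hcB : B.card = ∑ k ∈ s, (B.filter fun b => κB b = k).card :=
      Finset.card_eq_sum_card_fiberwise fun b hb =>
        Finset.mem_union_right _ (Finset.mem_image_of_mem _ hb)
    rw [e.symm.sum_comp fun p : Σ k : s, Fin (m k) =>
        ((S p.1 p.2).card : NNReal) + ((T p.1 p.2).card : NNReal), Fintype.sum_sigma,
      Finset.sum_coe_sort s fun k => ∑ i, (((S k i).card : NNReal) + ((T k i).card : NNReal)),
      hcA, hcB, ← Finset.sum_add_distrib]
    exact (Finset.sum_le_sum fun k _ => hw k).trans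
      (sum_le_apply_sum_of_superadditive f hf s _)
end

section
/- There exists an absolute constant C such that for all finite sets A, B of real numbers with |A| + |B| = n ≥ 2, the relation R = {(a,b) ∈ A × B : a < b} admits a duplicate-free depth-3 factorization of size at most C · n · (1 + log₂(1 + log₂ n)). -/
/-- A depth-3 factorization of the relation `R` restricted to `A × B`: intermediate node layers
`Fin x` and `Fin y` with edge sets `E1 ⊆ A × X`, `E2 ⊆ X × Y`, `E3 ⊆ Y × B` such that a pair
`(a, b) ∈ A × B` is in `R` iff it is connected by a length-3 path through the two layers. -/
def IsDepth3Fact {α β : Type*} (A : Finset α) (B : Finset β) (R : α → β → Prop)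
    {x y : ℕ} (E1 : Finset (α × Fin x)) (E2 : Finset (Fin x × Fin y))
    (E3 : Finset (Fin y × β)) : Prop :=
  (∀ e ∈ E1, e.1 ∈ A) ∧ (∀ e ∈ E3, e.2 ∈ B) ∧
  ∀ a ∈ A, ∀ b ∈ B,
    (R a b ↔ ∃ (i : Fin x) (j : Fin y), (a, i) ∈ E1 ∧ (i, j) ∈ E2 ∧ (j, b) ∈ E3)

/-- A depth-3 factorization is duplicate-free if every pair of `R` has a unique witnessing
pair of intermediate nodes. -/
def IsDupFree {α β : Type*} (A : Finset α) (B : Finset β) (R : α → β → Prop)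
    {x y : ℕ} (E1 : Finset (α × Fin x)) (E2 : Finset (Fin x × Fin y))
    (E3 : Finset (Fin y × β)) : Prop :=
  ∀ a ∈ A, ∀ b ∈ B, R a b →
    ∃! w : Fin x × Fin y, (a, w.1) ∈ E1 ∧ (w.1, w.2) ∈ E2 ∧ (w.2, b) ∈ E3

/-- The block of width `2 ^ 2 ^ t` containing `2 * r`. At level `0` this is `r` itself, and each
block of level `t + 1` consists of `2 ^ 2 ^ t` blocks of level `t`. -/
def rankBlock (t r : ℕ) : ℕ := 2 * r / 2 ^ 2 ^ t

theorem rankBlock_zero (r : ℕ) : rankBlock 0 r = r := by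
  simp [rankBlock]

theorem rankBlock_succ (t r : ℕ) : rankBlock (t + 1) r = rankBlock t r / 2 ^ 2 ^ t := by
  rw [rankBlock, rankBlock, Nat.div_div_eq_div_mul, ← pow_add, ← two_mul, pow_succ, mul_comm (2 ^ t)]

theorem rankBlock_mono (t : ℕ) : Monotone (rankBlock t) := fun _ _ h =>
  Nat.div_le_div_right (Nat.mul_le_mul_left 2 h)

theorem rankBlock_le (t r : ℕ) : rankBlock t r ≤ r := by
  induction t with
  | zero => exact (rankBlock_zero r).le
  | succ t ih => exact rankBlock_succ t r ▸ (Nat.div_le_self _ _).trans ih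

theorem rankBlock_mul_le (t r : ℕ) : rankBlock t r * 2 ^ 2 ^ t ≤ 2 * r :=
  Nat.div_mul_le_self _ _

theorem rankBlock_eq_of_le {s t r r' : ℕ} (hst : s ≤ t) (h : rankBlock s r = rankBlock s r') :
    rankBlock t r = rankBlock t r' := by
  induction t, hst using Nat.le_induction with
  | base => exact h
  | succ t _ ih => rw [rankBlock_succ, rankBlock_succ, ih]

/-- Two ranks in the same block at level `K` are separated at exactly one level below `K`. -/
theorem existsUnique_rankBlock_separation {K r r' : ℕ} (h : r < r')
    (hK : rankBlock K r = rankBlock K r') :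
    ∃! t, t < K ∧ rankBlock t r < rankBlock t r' ∧ rankBlock (t + 1) r = rankBlock (t + 1) r' := by
  have hex : ∃ t, rankBlock t r = rankBlock t r' := ⟨K, hK⟩
  have hpos : Nat.find hex ≠ 0 := fun h0 => by
    have := Nat.find_spec hex
    rw [h0, rankBlock_zero, rankBlock_zero] at this
    omega
  obtain ⟨t, ht⟩ := Nat.exists_eq_succ_of_ne_zero hpos
  refine ⟨t, ⟨?_, ?_, ?_⟩, ?_⟩
  · have := Nat.find_min' hex hK
    omega
  · exact (rankBlock_mono t h.le).lt_of_ne (Nat.find_min hex (by omega))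
  · have := Nat.find_spec hex
    rwa [ht] at this
  · rintro s ⟨_, hlt, heq⟩
    have h1 := Nat.find_min' hex heq
    have h2 : ¬ Nat.find hex ≤ s := fun hle =>
      hlt.ne (rankBlock_eq_of_le hle (Nat.find_spec hex))
    omega

/-- A strict comparison of ranks bounded by `n` factors through one layer of blocks for each
of the levels below `K`. -/
theorem exists_depth3Fact_of_rank {α : Type*} (A B : Finset α) (r : α → ℕ) {n K : ℕ}
    (hr : ∀ a, r a ≤ n) (hlt : ∀ t < K, 2 ^ 2 ^ t ≤ 2 * n) (hK : 2 * n < 2 ^ 2 ^ K) :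
    ∃ (x y : ℕ) (E1 : Finset (α × Fin x)) (E2 : Finset (Fin x × Fin y))
      (E3 : Finset (Fin y × α)),
      IsDepth3Fact A B (fun a b => r a < r b) E1 E2 E3 ∧
      IsDupFree A B (fun a b => r a < r b) E1 E2 E3 ∧
      E1.card + E2.card + E3.card ≤ (A.card + B.card + 4 * n) * K := by
  classical
  let e : Fin (K * (n + 1)) ≃ Fin K × Fin (n + 1) := finProdFinEquiv.symm
  let E1 : Finset (α × Fin (K * (n + 1))) :=
    (A ×ˢ Finset.univ).filter fun w => ((e w.2).2 : ℕ) = rankBlock (e w.2).1 (r w.1)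
  let E2 : Finset (Fin (K * (n + 1)) × Fin (K * (n + 1))) :=
    Finset.univ.filter fun w => (e w.1).1 = (e w.2).1 ∧ (e w.1).2 < (e w.2).2 ∧
      ((e w.1).2 : ℕ) / 2 ^ 2 ^ ((e w.1).1 : ℕ) = ((e w.2).2 : ℕ) / 2 ^ 2 ^ ((e w.1).1 : ℕ) ∧
      ((e w.1).2 : ℕ) * 2 ^ 2 ^ ((e w.1).1 : ℕ) ≤ 2 * n
  let E3 : Finset (Fin (K * (n + 1)) × α) :=
    (Finset.univ ×ˢ B).filter fun w => ((e w.1).2 : ℕ) = rankBlock (e w.1).1 (r w.2)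
  have hpath : ∀ a ∈ A, ∀ b ∈ B, ∀ i j, ((a, i) ∈ E1 ∧ (i, j) ∈ E2 ∧ (j, b) ∈ E3) →
      (((e i).1 : ℕ) < K ∧ rankBlock (e i).1 (r a) < rankBlock (e i).1 (r b) ∧
        rankBlock ((e i).1 + 1) (r a) = rankBlock ((e i).1 + 1) (r b)) ∧
      (e i).1 = (e j).1 ∧ ((e i).2 : ℕ) = rankBlock (e i).1 (r a) ∧
      ((e j).2 : ℕ) = rankBlock (e i).1 (r b) := by
    intro a _ b _ i j h
    simp only [E1, E2, E3, Finset.mem_filter, Finset.mem_product, Finset.mem_univ, true_and,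
      and_true] at h
    obtain ⟨⟨_, h1⟩, ⟨hl, hpq, hdiv, _⟩, ⟨_, h3⟩⟩ := h
    rw [← hl] at h3
    refine ⟨⟨(e i).1.isLt, ?_, ?_⟩, hl, h1, h3⟩
    · rw [← h1, ← h3]
      exact hpq
    · rw [rankBlock_succ, rankBlock_succ, ← h1, ← h3, hdiv]
  have hex : ∀ a ∈ A, ∀ b ∈ B, r a < r b →
      ∃! w : Fin (K * (n + 1)) × Fin (K * (n + 1)),
        (a, w.1) ∈ E1 ∧ (w.1, w.2) ∈ E2 ∧ (w.2, b) ∈ E3 := by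
    intro a ha b hb hab
    have hzero : ∀ c, rankBlock K (r c) = 0 := fun c =>
      Nat.div_eq_of_lt ((Nat.mul_le_mul_left 2 (hr c)).trans_lt hK)
    obtain ⟨t, ⟨htK, hsep, hjoin⟩, huniq⟩ :=
      existsUnique_rankBlock_separation hab ((hzero a).trans (hzero b).symm)
    have hle : ∀ c, rankBlock t (r c) < n + 1 := fun c =>
      Nat.lt_succ_of_le ((rankBlock_le t (r c)).trans (hr c))
    refine ⟨(e.symm (⟨t, htK⟩, ⟨_, hle a⟩), e.symm (⟨t, htK⟩, ⟨_, hle b⟩)), ?_, ?_⟩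
    · rw [rankBlock_succ, rankBlock_succ] at hjoin
      simp only [E1, E2, E3, Finset.mem_filter, Finset.mem_product, Finset.mem_univ, true_and,
        and_true, Equiv.apply_symm_apply, Fin.mk_lt_mk]
      exact ⟨ha, ⟨hsep, hjoin, (rankBlock_mul_le t _).trans (Nat.mul_le_mul_left 2 (hr a))⟩, hb⟩
    · rintro ⟨i, j⟩ h
      obtain ⟨hlev, hij, hi, hj⟩ := hpath a ha b hb i j h
      have ht := huniq _ hlev
      rw [ht] at hi hj
      ext1
      · exact e.eq_symm_apply.2 (Prod.ext (Fin.ext ht) (Fin.ext hi))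
      · exact e.eq_symm_apply.2 (Prod.ext (Fin.ext (hij ▸ ht)) (Fin.ext hj))
  have hE1 : E1.card ≤ A.card * K := by
    have : E1.card ≤ (A ×ˢ (Finset.univ : Finset (Fin K))).card := by
      refine Finset.card_le_card_of_injOn (fun w => (w.1, (e w.2).1)) ?_ ?_
      · intro w hw
        simp only [E1, Finset.coe_filter, Finset.mem_product, Set.mem_ofPred_eq] at hw
        simp [hw.1.1]
      · rintro ⟨a, i⟩ hi ⟨b, j⟩ hj h
        simp only [E1, Finset.coe_filter, Set.mem_ofPred_eq] at hi hj
        simp only [Prod.mk.injEq] at h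
        obtain ⟨rfl, h⟩ := h
        rw [h, ← hj.2] at hi
        exact Prod.ext rfl (e.injective (Prod.ext h (Fin.ext hi.2)))
    simpa using this
  have hE3 : E3.card ≤ B.card * K := by
    have : E3.card ≤ (B ×ˢ (Finset.univ : Finset (Fin K))).card := by
      refine Finset.card_le_card_of_injOn (fun w => (w.2, (e w.1).1)) ?_ ?_
      · intro w hw
        simp only [E3, Finset.coe_filter, Finset.mem_product, Set.mem_ofPred_eq] at hw
        simp [hw.1.2]
      · rintro ⟨i, a⟩ hi ⟨j, b⟩ hj h
        simp only [E3, Finset.coe_filter, Set.mem_ofPred_eq] at hi hj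
        simp only [Prod.mk.injEq] at h
        obtain ⟨rfl, h⟩ := h
        rw [h, ← hj.2] at hi
        exact Prod.ext (e.injective (Prod.ext h (Fin.ext hi.2))) rfl
    simpa using this
  have hE2 : E2.card ≤ 4 * n * K := by
    have : E2.card ≤ (Finset.range (4 * n) ×ˢ (Finset.univ : Finset (Fin K))).card := by
      refine Finset.card_le_card_of_injOn
        (fun w => (((e w.1).2 : ℕ) * 2 ^ 2 ^ ((e w.1).1 : ℕ) +
          ((e w.2).2 : ℕ) % 2 ^ 2 ^ ((e w.1).1 : ℕ), (e w.1).1)) ?_ ?_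
      · intro w hw
        simp only [E2, Finset.coe_filter, Set.mem_ofPred_eq] at hw
        have h1 := hlt _ (e w.1).1.isLt
        have h2 := Nat.mod_lt ((e w.2).2 : ℕ) (Nat.two_pow_pos (2 ^ ((e w.1).1 : ℕ)))
        simp only [Finset.coe_product, Set.mem_prod, Finset.mem_coe, Finset.mem_range,
          Finset.mem_univ, and_true]
        omega
      · rintro ⟨i, j⟩ hi ⟨i', j'⟩ hi' h
        simp only [E2, Finset.coe_filter, Set.mem_ofPred_eq, Finset.mem_univ, true_and] at hi hi'
        simp only [Prod.mk.injEq] at h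
        obtain ⟨h, hl⟩ := h
        rw [← hl] at h hi'
        obtain ⟨hij, -, hdiv, -⟩ := hi
        obtain ⟨hij', -, hdiv', -⟩ := hi'
        have hpos := Nat.two_pow_pos (2 ^ ((e i).1 : ℕ))
        generalize 2 ^ 2 ^ ((e i).1 : ℕ) = d at *
        have hp : ((e i).2 : ℕ) = (e i').2 := by
          have := congrArg (· / d) h
          simpa [Nat.mul_add_div, mul_comm _ d, hpos, Nat.div_eq_of_lt (Nat.mod_lt _ hpos)]
            using this
        have hq : ((e j).2 : ℕ) = (e j').2 := by
          rw [← Nat.div_add_mod ((e j).2 : ℕ) d, ← Nat.div_add_mod ((e j').2 : ℕ) d, ← hdiv,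
            ← hdiv', hp]
          rw [hp] at h
          omega
        exact Prod.ext (e.injective (Prod.ext hl (Fin.ext hp)))
          (e.injective (Prod.ext (hij.symm.trans hij') (Fin.ext hq)))
    simpa using this
  refine ⟨_, _, E1, E2, E3, ⟨?_, ?_, ?_⟩, hex, ?_⟩
  · intro w hw
    exact (Finset.mem_product.1 (Finset.mem_filter.1 hw).1).1
  · intro w hw
    exact (Finset.mem_product.1 (Finset.mem_filter.1 hw).1).2
  · intro a ha b hb
    refine ⟨fun hab => ?_, ?_⟩
    · obtain ⟨w, hw, -⟩ := hex a ha b hb hab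
      exact ⟨w.1, w.2, hw⟩
    · rintro ⟨i, j, h⟩
      exact (rankBlock_mono _).reflect_lt (hpath a ha b hb i j h).1.2.1
  · linarith

/-- Multiway partitioning for a single strict inequality: the relation `{(a,b) : a < b}` on
`A, B ⊆ ℝ` with `|A| + |B| = n ≥ 2` admits a duplicate-free depth-3 factorization of size
at most `C · n · (1 + log₂(1 + log₂ n))` for an absolute constant `C`. -/
theorem inequality_depth3_factorization :
    ∃ C : ℝ, ∀ (A B : Finset ℝ) (n : ℕ), A.card + B.card = n → 2 ≤ n →
      ∃ (x y : ℕ) (E1 : Finset (ℝ × Fin x)) (E2 : Finset (Fin x × Fin y))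
        (E3 : Finset (Fin y × ℝ)),
        IsDepth3Fact A B (fun a b => a < b) E1 E2 E3 ∧
        IsDupFree A B (fun a b => a < b) E1 E2 E3 ∧
        ((E1.card : ℝ) + (E2.card : ℝ) + (E3.card : ℝ)) ≤
          C * n * (1 + Real.logb 2 (1 + Real.logb 2 n)) := by
  refine ⟨5, fun A B n hn h2 => ?_⟩
  let r : ℝ → ℕ := fun a => ((A ∪ B).filter (· < a)).card
  have hr : ∀ a, r a ≤ n := fun a =>
    (Finset.card_filter_le _ _).trans ((Finset.card_union_le A B).trans hn.le)
  have hmono : Monotone r := fun a b hab =>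
    Finset.card_le_card (Finset.monotone_filter_right _ fun _ _ h => h.trans_le hab)
  have hrank : ∀ a ∈ A, ∀ b, r a < r b ↔ a < b := fun a ha b =>
    ⟨hmono.reflect_lt, fun hab => Finset.card_lt_card <| by
      refine (Finset.ssubset_iff_of_subset
        (Finset.monotone_filter_right _ fun _ _ h => h.trans hab)).2 ⟨a, ?_, ?_⟩
      · simp [ha, hab]
      · simp⟩
  have hlog : Nat.log 2 (2 * n) = Nat.log 2 n + 1 := by
    rw [mul_comm, Nat.log_mul_base (by norm_num) (by omega)]
  obtain ⟨x, y, E1, E2, E3, ⟨hA, hB, hE⟩, hdup, hcard⟩ :=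
    exists_depth3Fact_of_rank A B r (n := n) (K := Nat.log 2 (Nat.log 2 (2 * n)) + 1) hr
      (fun t ht => Nat.pow_le_of_le_log (by omega)
        (Nat.pow_le_of_le_log (by omega) (Nat.lt_succ_iff.1 ht)))
      (Nat.lt_pow_of_log_lt one_lt_two (Nat.lt_pow_succ_log_self one_lt_two _))
  refine ⟨x, y, E1, E2, E3, ⟨hA, hB, fun a ha b hb => ?_⟩, fun a ha b hb hab => ?_, ?_⟩
  · exact (hrank a ha b).symm.trans (hE a ha b hb)
  · exact hdup a ha b hb ((hrank a ha b).2 hab)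
  have hK : ((Nat.log 2 (Nat.log 2 (2 * n)) + 1 : ℕ) : ℝ) ≤
      1 + Real.logb 2 (1 + Real.logb 2 n) := by
    have h1 : (Nat.log 2 n : ℝ) ≤ Real.logb 2 n := by
      exact_mod_cast Real.natLog_le_logb n 2
    have h3 : (Nat.log 2 (Nat.log 2 n + 1) : ℝ) ≤ Real.logb 2 ((Nat.log 2 n + 1 : ℕ) : ℝ) := by
      exact_mod_cast Real.natLog_le_logb (Nat.log 2 n + 1) 2
    have h4 : Real.logb 2 ((Nat.log 2 n + 1 : ℕ) : ℝ) ≤ Real.logb 2 (1 + Real.logb 2 n) :=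
      Real.logb_le_logb_of_le one_lt_two (by positivity) (by push_cast; linarith)
    rw [hlog]
    push_cast
    linarith
  rw [hn, show n + 4 * n = 5 * n by ring] at hcard
  calc ((E1.card : ℝ) + E2.card + E3.card)
      ≤ 5 * n * (Nat.log 2 (Nat.log 2 (2 * n)) + 1 : ℕ) := by exact_mod_cast hcard
    _ ≤ _ := mul_le_mul_of_nonneg_left hK (by positivity)
end

section
/- There exists an absolute constant C such that for all finite sets A, B of real numbers with |A| + |B| = n ≥ 2, the relation R = {(a,b) ∈ A × B : a ≠ b} admits a duplicate-free depth-3 factorization of size at most C · n · (1 + log₂(1 + log₂ n)). -/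
/-- The intermediate layers of a duplicate-free depth-3 factorization may be taken in arbitrary
finite types instead of `Fin x` and `Fin y`. -/
theorem exists_fin_depth3_of_fintype {α β X Y : Type*} [Fintype X] [Fintype Y]
    (A : Finset α) (B : Finset β) (R : α → β → Prop)
    (E1 : Finset (α × X)) (E2 : Finset (X × Y)) (E3 : Finset (Y × β))
    (h1 : ∀ e ∈ E1, e.1 ∈ A) (h3 : ∀ e ∈ E3, e.2 ∈ B)
    (hsound : ∀ a ∈ A, ∀ b ∈ B, ∀ i j, (a, i) ∈ E1 → (i, j) ∈ E2 → (j, b) ∈ E3 → R a b)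
    (huniq : ∀ a ∈ A, ∀ b ∈ B, R a b →
      ∃! w : X × Y, (a, w.1) ∈ E1 ∧ (w.1, w.2) ∈ E2 ∧ (w.2, b) ∈ E3) :
    ∃ (x y : ℕ) (F1 : Finset (α × Fin x)) (F2 : Finset (Fin x × Fin y))
      (F3 : Finset (Fin y × β)),
      IsDepth3Fact A B R F1 F2 F3 ∧ IsDupFree A B R F1 F2 F3 ∧
      F1.card = E1.card ∧ F2.card = E2.card ∧ F3.card = E3.card := by
  let f := Fintype.equivFin X
  let g := Fintype.equivFin Y
  have m1 : ∀ a i, (a, i) ∈ E1.map ((Equiv.refl α).prodCongr f).toEmbedding ↔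
      (a, f.symm i) ∈ E1 := fun a i => by
    rw [Finset.mem_map_equiv]; rfl
  have m2 : ∀ i j, (i, j) ∈ E2.map (f.prodCongr g).toEmbedding ↔
      (f.symm i, g.symm j) ∈ E2 := fun i j => by
    rw [Finset.mem_map_equiv]; rfl
  have m3 : ∀ j b, (j, b) ∈ E3.map (g.prodCongr (Equiv.refl β)).toEmbedding ↔
      (g.symm j, b) ∈ E3 := fun j b => by
    rw [Finset.mem_map_equiv]; rfl
  have hdup : IsDupFree A B R (E1.map ((Equiv.refl α).prodCongr f).toEmbedding)
      (E2.map (f.prodCongr g).toEmbedding)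
      (E3.map (g.prodCongr (Equiv.refl β)).toEmbedding) := by
    intro a ha b hb hab
    obtain ⟨w, hw, hw'⟩ := huniq a ha b hb hab
    refine ⟨(f w.1, g w.2), by simpa [m1, m2, m3] using hw, ?_⟩
    rintro ⟨i, j⟩ hij
    have := hw' (f.symm i, g.symm j) (by simpa only [m1, m2, m3] using hij)
    simp [← this]
  refine ⟨_, _, _, _, _, ⟨?_, ?_, fun a ha b hb => ⟨fun hab => ?_, ?_⟩⟩, hdup,
    Finset.card_map _, Finset.card_map _, Finset.card_map _⟩
  · rintro ⟨a, i⟩ he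
    exact h1 _ ((m1 a i).1 he)
  · rintro ⟨j, b⟩ he
    exact h3 _ ((m3 j b).1 he)
  · obtain ⟨w, hw, -⟩ := hdup a ha b hb hab
    exact ⟨w.1, w.2, hw⟩
  · rintro ⟨i, j, hi, hij, hj⟩
    exact hsound a ha b hb _ _ ((m1 a i).1 hi) ((m2 i j).1 hij) ((m3 j b).1 hj)

/-- A downward closed predicate on `ℕ` that holds at `0` and fails at `k` switches exactly once
below `k`. -/
theorem existsUnique_switch {P : ℕ → Prop} (hP : ∀ j, P (j + 1) → P j) (h0 : P 0) {k : ℕ}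
    (hk : ¬ P k) : ∃! i : Fin k, P i ∧ ¬ P (i + 1) := by
  classical
  have hanti : ∀ {i j : ℕ}, i ≤ j → P j → P i := by
    intro i j hij
    induction hij with
    | refl => exact id
    | step _ ih => exact fun h => ih (hP _ h)
  have hex : ∃ j, ¬ P j := ⟨k, hk⟩
  have hpos : Nat.find hex ≠ 0 := fun h => Nat.find_spec hex (h ▸ h0)
  have hle : Nat.find hex ≤ k := Nat.find_min' hex hk
  refine ⟨⟨Nat.find hex - 1, by omega⟩, ⟨?_, ?_⟩, ?_⟩
  · exact not_not.1 (Nat.find_min hex (m := Nat.find hex - 1) (by omega))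
  · have h : Nat.find hex - 1 + 1 = Nat.find hex := by omega
    simpa only [h] using Nat.find_spec hex
  · rintro ⟨i, hi⟩ ⟨h1, h2⟩
    have ha : Nat.find hex ≤ i + 1 := Nat.find_min' hex h2
    have hb : i < Nat.find hex := by
      by_contra! h
      exact Nat.find_spec hex (hanti h h1)
    ext
    simp only
    omega

/-- The block of length `2 ^ (e / 2 ^ j)` containing `m`. -/
def dyadicBlock (e j m : ℕ) : ℕ := m / 2 ^ (e / 2 ^ j)

theorem dyadicBlock_le (e j m : ℕ) : dyadicBlock e j m ≤ m := Nat.div_le_self _ _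

theorem div_two_pow_succ_le (e j : ℕ) : e / 2 ^ (j + 1) ≤ e / 2 ^ j :=
  Nat.div_le_div_left (Nat.pow_le_pow_right (by norm_num) (Nat.le_succ j)) (by positivity)

theorem dyadicBlock_succ_div (e j m : ℕ) :
    dyadicBlock e (j + 1) m / 2 ^ (e / 2 ^ j - e / 2 ^ (j + 1)) = dyadicBlock e j m := by
  rw [dyadicBlock, dyadicBlock, Nat.div_div_eq_div_mul, ← pow_add,
    Nat.add_sub_cancel' (div_two_pow_succ_le e j)]

/-- Edges between blocks of level `i + 1` that are distinct but lie in the same block of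
level `i`. -/
def siblingEdges (k e : ℕ) : Finset ((Fin k × Fin (2 ^ e)) × (Fin k × Fin (2 ^ e))) :=
  Finset.univ.filter fun p => p.1.1 = p.2.1 ∧ p.1.2 ≠ p.2.2 ∧
    (p.1.2 : ℕ) < 2 ^ (e - e / 2 ^ ((p.1.1 : ℕ) + 1)) ∧
    (p.1.2 : ℕ) / 2 ^ (e / 2 ^ (p.1.1 : ℕ) - e / 2 ^ ((p.1.1 : ℕ) + 1)) =
      (p.2.2 : ℕ) / 2 ^ (e / 2 ^ (p.1.1 : ℕ) - e / 2 ^ ((p.1.1 : ℕ) + 1))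

theorem card_siblingEdges_le (k e : ℕ) : (siblingEdges k e).card ≤ k * 2 ^ (e + 1) := by
  have hcard : ((Finset.univ : Finset (Fin k)) ×ˢ Finset.range (2 ^ (e + 1))).card =
      k * 2 ^ (e + 1) := by simp
  rw [← hcard]
  let s : Fin k → ℕ := fun i => e / 2 ^ (i : ℕ) - e / 2 ^ ((i : ℕ) + 1)
  refine Finset.card_le_card_of_injOn
    (fun p => (p.1.1, (p.1.2 : ℕ) * 2 ^ s p.1.1 + (p.2.2 : ℕ) % 2 ^ s p.1.1)) ?_ ?_
  · rintro ⟨⟨i, u⟩, ⟨j, v⟩⟩ hp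
    obtain ⟨-, -, hu, -⟩ := (Finset.mem_filter.1 hp).2
    simp only [Finset.coe_product, Set.mem_prod, Finset.coe_univ, Set.mem_univ, true_and,
      Finset.coe_range, Set.mem_Iio]
    simp only at hu
    have hmod : (v : ℕ) % 2 ^ s i < 2 ^ s i := Nat.mod_lt _ (by positivity)
    have hexp : (e - e / 2 ^ ((i : ℕ) + 1)) + s i ≤ e + 1 := by
      have hhalf : e / 2 ^ ((i : ℕ) + 1) = e / 2 ^ (i : ℕ) / 2 := by
        rw [pow_succ, Nat.div_div_eq_div_mul]
      have hle : e / 2 ^ (i : ℕ) ≤ e := Nat.div_le_self _ _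
      simp only [s, hhalf]
      generalize e / 2 ^ (i : ℕ) = m at hle
      omega
    calc (u : ℕ) * 2 ^ s i + (v : ℕ) % 2 ^ s i < ((u : ℕ) + 1) * 2 ^ s i := by
          rw [add_mul, one_mul]; omega
      _ ≤ 2 ^ (e - e / 2 ^ ((i : ℕ) + 1)) * 2 ^ s i := Nat.mul_le_mul_right _ hu
      _ = 2 ^ ((e - e / 2 ^ ((i : ℕ) + 1)) + s i) := (pow_add _ _ _).symm
      _ ≤ 2 ^ (e + 1) := Nat.pow_le_pow_right (by norm_num) hexp
  · rintro ⟨⟨i, u⟩, ⟨j, v⟩⟩ hp ⟨⟨i', u'⟩, ⟨j', v'⟩⟩ hp' heq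
    obtain ⟨hij, -, -, huv⟩ := (Finset.mem_filter.1 hp).2
    obtain ⟨hij', -, -, huv'⟩ := (Finset.mem_filter.1 hp').2
    simp only [Prod.mk.injEq] at heq hij hij' huv huv'
    obtain ⟨rfl, heq⟩ := heq
    subst hij hij'
    change (u : ℕ) / 2 ^ s i = v / 2 ^ s i at huv
    change (u' : ℕ) / 2 ^ s i = v' / 2 ^ s i at huv'
    have hpos : 0 < 2 ^ s i := by positivity
    have hu : (u : ℕ) = u' := by
      have h := congrArg (· / 2 ^ s i) heq
      simpa [Nat.mul_add_div hpos, mul_comm _ (2 ^ s i), Nat.div_eq_of_lt (Nat.mod_lt _ hpos)]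
        using h
    have hv : (v : ℕ) = v' := by
      rw [hu] at heq huv
      rw [← Nat.div_add_mod (v : ℕ) (2 ^ s i), ← Nat.div_add_mod (v' : ℕ) (2 ^ s i), ← huv,
        ← huv', Nat.add_left_cancel heq]
    rw [Fin.ext hu, Fin.ext hv]

/-- If `A ∪ B` embeds into `Fin (2 ^ e)` and `e < 2 ^ k`, then non-equality has a duplicate-free
depth-3 factorization with `k` edges at each outer node and `k * 2 ^ (e + 1)` inner edges. -/
theorem exists_depth3_ne_of_injOn {α : Type*} (A B : Finset α) {k e : ℕ} (hke : e < 2 ^ k)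
    (c : α → Fin (2 ^ e)) (hc : ∀ a ∈ A, ∀ b ∈ B, c a = c b → a = b) :
    ∃ (x y : ℕ) (F1 : Finset (α × Fin x)) (F2 : Finset (Fin x × Fin y))
      (F3 : Finset (Fin y × α)),
      IsDepth3Fact A B (fun a b => a ≠ b) F1 F2 F3 ∧
      IsDupFree A B (fun a b => a ≠ b) F1 F2 F3 ∧
      F1.card + F2.card + F3.card ≤ k * (A.card + B.card) + k * 2 ^ (e + 1) := by
  classical
  let d : Fin k → α → Fin (2 ^ e) := fun i a =>
    ⟨dyadicBlock e (i + 1) (c a), (dyadicBlock_le _ _ _).trans_lt (c a).2⟩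
  let E1 : Finset (α × (Fin k × Fin (2 ^ e))) :=
    (A ×ˢ Finset.univ).image fun p => (p.1, (p.2, d p.2 p.1))
  let E3 : Finset ((Fin k × Fin (2 ^ e)) × α) :=
    (B ×ˢ Finset.univ).image fun p => ((p.2, d p.2 p.1), p.1)
  have m1 : ∀ a i u, (a, (i, u)) ∈ E1 ↔ a ∈ A ∧ d i a = u := by
    intro a i u
    simp only [E1, Finset.mem_image, Finset.mem_product, Finset.mem_univ, and_true, Prod.exists,
      Prod.mk.injEq]
    constructor
    · rintro ⟨a', i', ha, rfl, rfl, rfl⟩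
      exact ⟨ha, rfl⟩
    · rintro ⟨ha, rfl⟩
      exact ⟨a, i, ha, rfl, rfl, rfl⟩
  have m3 : ∀ b i u, ((i, u), b) ∈ E3 ↔ b ∈ B ∧ d i b = u := by
    intro a i u
    simp only [E3, Finset.mem_image, Finset.mem_product, Finset.mem_univ, and_true, Prod.exists,
      Prod.mk.injEq]
    constructor
    · rintro ⟨a', i', ha, ⟨rfl, rfl⟩, rfl⟩
      exact ⟨ha, rfl⟩
    · rintro ⟨ha, rfl⟩
      exact ⟨a, i, ha, ⟨rfl, rfl⟩, rfl⟩
  have m2 : ∀ (i j : Fin k) (a b : α), ((i, d i a), (j, d j b)) ∈ siblingEdges k e ↔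
      i = j ∧ dyadicBlock e i (c a) = dyadicBlock e i (c b) ∧
        dyadicBlock e (i + 1) (c a) ≠ dyadicBlock e (i + 1) (c b) := by
    intro i j a b
    simp only [siblingEdges, Finset.mem_filter, Finset.mem_univ, true_and]
    refine and_congr_right ?_
    rintro rfl
    have hlt : (d i a : ℕ) < 2 ^ (e - e / 2 ^ ((i : ℕ) + 1)) := by
      refine Nat.div_lt_of_lt_mul ?_
      rw [← pow_add, Nat.add_sub_cancel' (Nat.div_le_self _ _)]
      exact (c a).2
    simp only [hlt, true_and, d, dyadicBlock_succ_div, ne_eq, Fin.mk.injEq]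
    exact and_comm
  obtain ⟨x, y, F1, F2, F3, hF, hdup, hc1, hc2, hc3⟩ :=
    exists_fin_depth3_of_fintype A B (fun a b => a ≠ b) E1 (siblingEdges k e) E3
      (fun ⟨a, i, u⟩ h => ((m1 a i u).1 h).1) (fun ⟨⟨i, u⟩, b⟩ h => ((m3 b i u).1 h).1)
      (by
        rintro a - b - ⟨i, u⟩ ⟨j, v⟩ h1 h2 h3 rfl
        obtain ⟨-, rfl⟩ := (m1 _ _ _).1 h1
        obtain ⟨-, rfl⟩ := (m3 _ _ _).1 h3
        exact ((m2 _ _ _ _).1 h2).2.2 rfl)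
      (by
        intro a ha b hb hab
        obtain ⟨i, hi, hi'⟩ := existsUnique_switch (k := k)
          (P := fun j => dyadicBlock e j (c a) = dyadicBlock e j (c b))
          (fun j h => by
            rw [← dyadicBlock_succ_div, h, dyadicBlock_succ_div])
          (by simp [dyadicBlock, Nat.div_eq_of_lt (c a).2, Nat.div_eq_of_lt (c b).2])
          (fun h => hab (hc a ha b hb (Fin.ext (by
            simpa [dyadicBlock, Nat.div_eq_of_lt hke] using h))))
        refine ⟨((i, d i a), (i, d i b)),
          ⟨(m1 _ _ _).2 ⟨ha, rfl⟩, (m2 _ _ _ _).2 ⟨rfl, hi⟩, (m3 _ _ _).2 ⟨hb, rfl⟩⟩, ?_⟩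
        rintro ⟨⟨i', u⟩, ⟨j, v⟩⟩ ⟨h1, h2, h3⟩
        obtain ⟨-, rfl⟩ := (m1 _ _ _).1 h1
        obtain ⟨-, rfl⟩ := (m3 _ _ _).1 h3
        obtain ⟨rfl, h⟩ := (m2 _ _ _ _).1 h2
        rw [hi' i' h])
  refine ⟨x, y, F1, F2, F3, hF, hdup, ?_⟩
  have h1 : E1.card ≤ k * A.card := by
    simpa [mul_comm] using (Finset.card_image_le : E1.card ≤ (A ×ˢ Finset.univ).card)
  have h3 : E3.card ≤ k * B.card := by
    simpa [mul_comm] using (Finset.card_image_le : E3.card ≤ (B ×ˢ Finset.univ).card)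
  have h2 := card_siblingEdges_le k e
  rw [hc1, hc2, hc3, mul_add]
  omega

theorem natLog_add_one_le_logb {e : ℕ} {t : ℝ} (he : 0 < e) (het : (e : ℝ) ≤ t) :
    ((Nat.log 2 e + 1 : ℕ) : ℝ) ≤ 1 + Real.logb 2 t := by
  have he' : (0 : ℝ) < e := by exact_mod_cast he
  have h1 : (Nat.log 2 e : ℝ) ≤ Real.logb 2 e := by
    exact_mod_cast Real.natLog_le_logb e 2
  have h2 : Real.logb 2 e ≤ Real.logb 2 t := Real.logb_le_logb_of_le (by norm_num) he' het
  push_cast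
  linarith

/-- Factorization of a non-equality predicate: the relation `{(a,b) : a ≠ b}` on
`A, B ⊆ ℝ` with `|A| + |B| = n ≥ 2` admits a duplicate-free depth-3 factorization of size
at most `C · n · (1 + log₂(1 + log₂ n))` for an absolute constant `C`. -/
theorem nonequality_depth3_factorization :
    ∃ C : ℝ, ∀ (A B : Finset ℝ) (n : ℕ), A.card + B.card = n → 2 ≤ n →
      ∃ (x y : ℕ) (E1 : Finset (ℝ × Fin x)) (E2 : Finset (Fin x × Fin y))
        (E3 : Finset (Fin y × ℝ)),
        IsDepth3Fact A B (fun a b => a ≠ b) E1 E2 E3 ∧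
        IsDupFree A B (fun a b => a ≠ b) E1 E2 E3 ∧
        ((E1.card : ℝ) + (E2.card : ℝ) + (E3.card : ℝ)) ≤
          C * n * (1 + Real.logb 2 (1 + Real.logb 2 n)) := by
  classical
  refine ⟨5, fun A B n hn h2 => ?_⟩
  have hlog : (Nat.log 2 (n - 1) : ℝ) ≤ Real.logb 2 n := by
    refine (Real.natLog_le_logb (n - 1) 2).trans ?_
    refine Real.logb_le_logb_of_le (by norm_num) ?_ ?_
    · exact_mod_cast (by omega : 0 < n - 1)
    · exact_mod_cast Nat.sub_le n 1
  obtain ⟨e, he⟩ : ∃ e, e = Nat.log 2 (n - 1) + 1 := ⟨_, rfl⟩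
  obtain ⟨k, hk⟩ : ∃ k, k = Nat.log 2 e + 1 := ⟨_, rfl⟩
  have hne : n ≤ 2 ^ e := by
    have := Nat.lt_pow_succ_log_self (b := 2) (by norm_num) (n - 1)
    rw [he]
    omega
  have hen : 2 ^ (e + 1) ≤ 4 * n := by
    have := Nat.pow_log_le_self 2 (x := n - 1) (by omega)
    rw [he, pow_succ, pow_succ]
    omega
  have hke : e < 2 ^ k := hk ▸ Nat.lt_pow_succ_log_self (by norm_num) e
  have hcard : Fintype.card {r // r ∈ A ∪ B} ≤ Fintype.card (Fin (2 ^ e)) := by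
    rw [Fintype.card_coe, Fintype.card_fin]
    exact (Finset.card_union_le A B).trans (hn ▸ hne)
  obtain ⟨f⟩ := Function.Embedding.nonempty_of_card_le hcard
  let c : ℝ → Fin (2 ^ e) := fun r => if h : r ∈ A ∪ B then f ⟨r, h⟩ else ⟨0, by positivity⟩
  obtain ⟨x, y, F1, F2, F3, hF, hdup, hsize⟩ := exists_depth3_ne_of_injOn A B hke c (by
    intro a ha b hb hab
    have ha' : a ∈ A ∪ B := Finset.mem_union_left _ ha
    have hb' : b ∈ A ∪ B := Finset.mem_union_right _ hb
    simpa only [c, dif_pos ha', dif_pos hb', f.injective.eq_iff, Subtype.mk.injEq] using hab)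
  refine ⟨x, y, F1, F2, F3, hF, hdup, ?_⟩
  have hkn : (k : ℝ) ≤ 1 + Real.logb 2 (1 + Real.logb 2 n) := by
    rw [hk]
    refine natLog_add_one_le_logb (by omega) ?_
    rw [he]
    push_cast
    linarith
  have hsize' : F1.card + F2.card + F3.card ≤ 5 * n * k := by
    rw [hn] at hsize
    nlinarith [Nat.mul_le_mul_left k hen]
  calc ((F1.card : ℝ) + F2.card + F3.card) ≤ 5 * n * k := by exact_mod_cast hsize'
    _ ≤ 5 * n * (1 + Real.logb 2 (1 + Real.logb 2 n)) := by gcongr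
end

section
/- There exists an absolute constant C such that for every ε > 0 and all finite sets A, B of real numbers with |A| + |B| = n ≥ 2, the relation R = {(a,b) ∈ A × B : |a − b| < ε} admits a duplicate-free depth-3 factorization of size at most C · n · (1 + log₂(1 + log₂ n)). -/
/-- `R` has a duplicate-free depth-3 factorization of size at most `s` on `A × B`, with
intermediate nodes taken from arbitrary types. -/
def HasDepth3Fact {α β : Type*} (A : Finset α) (B : Finset β) (R : α → β → Prop) (s : ℕ) : Prop :=
  ∃ (X Y : Type) (E1 : Finset (α × X)) (E2 : Finset (X × Y)) (E3 : Finset (Y × β)),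
    (∀ e ∈ E1, e.1 ∈ A) ∧ (∀ e ∈ E3, e.2 ∈ B) ∧
    (∀ a ∈ A, ∀ b ∈ B, R a b → ∃ i j, (a, i) ∈ E1 ∧ (i, j) ∈ E2 ∧ (j, b) ∈ E3) ∧
    (∀ a i j b, (a, i) ∈ E1 → (i, j) ∈ E2 → (j, b) ∈ E3 → R a b ∧
      ∀ i' j', (a, i') ∈ E1 → (i', j') ∈ E2 → (j', b) ∈ E3 → i' = i ∧ j' = j) ∧
    E1.card + E2.card + E3.card ≤ s

namespace HasDepth3Fact

variable {α β : Type*} {A : Finset α} {B : Finset β} {R S : α → β → Prop} {s t : ℕ}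

theorem congr (h : HasDepth3Fact A B R s) (hRS : ∀ a ∈ A, ∀ b ∈ B, (R a b ↔ S a b)) :
    HasDepth3Fact A B S s := by
  obtain ⟨X, Y, E1, E2, E3, hA, hB, hex, huniq, hs⟩ := h
  refine ⟨X, Y, E1, E2, E3, hA, hB, fun a ha b hb hab => hex a ha b hb ((hRS a ha b hb).2 hab),
    fun a i j b h1 h2 h3 => ?_, hs⟩
  obtain ⟨hR, hu⟩ := huniq a i j b h1 h2 h3
  exact ⟨(hRS a (hA _ h1) b (hB _ h3)).1 hR, hu⟩

theorem mono (h : HasDepth3Fact A B R s) (hst : s ≤ t) : HasDepth3Fact A B R t := by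
  obtain ⟨X, Y, E1, E2, E3, hA, hB, hex, huniq, hs⟩ := h
  exact ⟨X, Y, E1, E2, E3, hA, hB, hex, huniq, hs.trans hst⟩

theorem of_forall_not (h : ∀ a b, ¬ R a b) : HasDepth3Fact A B R 0 :=
  ⟨Empty, Empty, ∅, ∅, ∅, by simp, by simp, fun a _ b _ hab => (h a b hab).elim, by simp, by simp⟩

/-- The disjoint union of two factorizations factors the union of two disjoint relations. -/
theorem or (hR : HasDepth3Fact A B R s) (hS : HasDepth3Fact A B S t)
    (hdisj : ∀ a b, R a b → ¬ S a b) :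
    HasDepth3Fact A B (fun a b => R a b ∨ S a b) (s + t) := by
  classical
  obtain ⟨X, Y, E1, E2, E3, hA, hB, hex, huniq, hs⟩ := hR
  obtain ⟨X', Y', F1, F2, F3, hA', hB', hex', huniq', ht⟩ := hS
  refine ⟨X ⊕ X', Y ⊕ Y',
    E1.image (Prod.map id Sum.inl) ∪ F1.image (Prod.map id Sum.inr),
    E2.image (Prod.map Sum.inl Sum.inl) ∪ F2.image (Prod.map Sum.inr Sum.inr),
    E3.image (Prod.map Sum.inl id) ∪ F3.image (Prod.map Sum.inr id), ?_, ?_, ?_, ?_, ?_⟩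
  · simp only [Finset.mem_union, Finset.mem_image]
    rintro _ (⟨e, he, rfl⟩ | ⟨e, he, rfl⟩)
    exacts [hA e he, hA' e he]
  · simp only [Finset.mem_union, Finset.mem_image]
    rintro _ (⟨e, he, rfl⟩ | ⟨e, he, rfl⟩)
    exacts [hB e he, hB' e he]
  · rintro a ha b hb (h | h)
    · obtain ⟨i, j, h1, h2, h3⟩ := hex a ha b hb h
      exact ⟨.inl i, .inl j, by simp [h1], by simp [h2], by simp [h3]⟩
    · obtain ⟨i, j, h1, h2, h3⟩ := hex' a ha b hb h
      exact ⟨.inr i, .inr j, by simp [h1], by simp [h2], by simp [h3]⟩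
  · rintro a (i | i) (j | j) b h1 h2 h3 <;> simp at h1 h2 h3
    · obtain ⟨h, hu⟩ := huniq a i j b h1 h2 h3
      refine ⟨.inl h, ?_⟩
      rintro (i' | i') (j' | j') k1 k2 k3 <;> simp at k1 k2 k3
      · simpa using hu i' j' k1 k2 k3
      · exact (hdisj a b h (huniq' a i' j' b k1 k2 k3).1).elim
    · obtain ⟨h, hu⟩ := huniq' a i j b h1 h2 h3
      refine ⟨.inr h, ?_⟩
      rintro (i' | i') (j' | j') k1 k2 k3 <;> simp at k1 k2 k3
      · exact (hdisj a b (huniq a i' j' b k1 k2 k3).1 h).elim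
      · simpa using hu i' j' k1 k2 k3
  · have h1 := (Finset.card_union_le (E1.image (Prod.map id (Sum.inl (β := X'))))
      (F1.image (Prod.map id Sum.inr))).trans (add_le_add Finset.card_image_le Finset.card_image_le)
    have h2 := (Finset.card_union_le (E2.image (Prod.map (Sum.inl (β := X')) (Sum.inl (β := Y'))))
      (F2.image (Prod.map Sum.inr Sum.inr))).trans
      (add_le_add Finset.card_image_le Finset.card_image_le)
    have h3 := (Finset.card_union_le (E3.image (Prod.map (Sum.inl (β := Y')) id))
      (F3.image (Prod.map Sum.inr id))).trans (add_le_add Finset.card_image_le Finset.card_image_le)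
    omega

/-- A relation pulled back from a finite edge set between node labels. -/
theorem of_maps {X Y : Type} (A : Finset α) (B : Finset β) (f : α → X) (g : β → Y)
    (E : Finset (X × Y)) :
    HasDepth3Fact A B (fun a b => (f a, g b) ∈ E) (A.card + E.card + B.card) := by
  classical
  refine ⟨X, Y, A.image fun a => (a, f a), E, B.image fun b => (g b, b), ?_, ?_, ?_, ?_, ?_⟩
  · simp
  · simp
  · intro a ha b hb h
    exact ⟨f a, g b, by simp [ha], h, by simp [hb]⟩
  · intro a i j b h1 h2 h3
    simp only [Finset.mem_image, Prod.mk.injEq] at h1 h3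
    obtain ⟨_, -, rfl, rfl⟩ := h1
    obtain ⟨_, -, rfl, rfl⟩ := h3
    refine ⟨h2, fun i' j' k1 _ k3 => ?_⟩
    simp only [Finset.mem_image, Prod.mk.injEq] at k1 k3
    obtain ⟨_, -, rfl, rfl⟩ := k1
    obtain ⟨_, -, rfl, rfl⟩ := k3
    exact ⟨rfl, rfl⟩
  · have h1 : (A.image fun a => (a, f a)).card ≤ A.card := Finset.card_image_le
    have h3 : (B.image fun b => (g b, b)).card ≤ B.card := Finset.card_image_le
    omega

/-- Only finitely many intermediate nodes matter, so they may be relabelled by `Fin`. -/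
theorem exists_fin (h : HasDepth3Fact A B R s) :
    ∃ (x y : ℕ) (E1 : Finset (α × Fin x)) (E2 : Finset (Fin x × Fin y)) (E3 : Finset (Fin y × β)),
      IsDepth3Fact A B R E1 E2 E3 ∧ IsDupFree A B R E1 E2 E3 ∧
        E1.card + E2.card + E3.card ≤ s := by
  classical
  obtain ⟨X, Y, E1, E2, E3, hA, hB, hex, huniq, hs⟩ := h
  have key : ∀ {Z : Type} (T : Finset Z), ∃ e : Fin T.card → Z,
      Function.Injective e ∧ ∀ z ∈ T, ∃ i, e i = z := fun T =>
    ⟨fun i => T.equivFin.symm i, Subtype.val_injective.comp T.equivFin.symm.injective,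
      fun z hz => ⟨T.equivFin ⟨z, hz⟩, by simp⟩⟩
  obtain ⟨e, he, hes⟩ := key (E2.image Prod.fst)
  obtain ⟨d, hd, hds⟩ := key (E2.image Prod.snd)
  have hmap1 : Function.Injective (Prod.map (id : α → α) e) := Function.injective_id.prodMap he
  have hmap2 : Function.Injective (Prod.map e d) := he.prodMap hd
  have hmap3 : Function.Injective (Prod.map d (id : β → β)) := hd.prodMap Function.injective_id
  have hex' : ∀ a ∈ A, ∀ b ∈ B, R a b →
      ∃ i j, (a, e i) ∈ E1 ∧ (e i, d j) ∈ E2 ∧ (d j, b) ∈ E3 := by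
    intro a ha b hb hab
    obtain ⟨i, j, h1, h2, h3⟩ := hex a ha b hb hab
    obtain ⟨i, rfl⟩ := hes i (Finset.mem_image_of_mem Prod.fst h2)
    obtain ⟨j, rfl⟩ := hds j (Finset.mem_image_of_mem Prod.snd h2)
    exact ⟨i, j, h1, h2, h3⟩
  refine ⟨_, _, E1.preimage _ hmap1.injOn, E2.preimage _ hmap2.injOn, E3.preimage _ hmap3.injOn,
    ⟨?_, ?_, ?_⟩, ?_, ?_⟩
  · intro p hp
    exact hA _ (Finset.mem_preimage.1 hp)
  · intro p hp
    exact hB _ (Finset.mem_preimage.1 hp)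
  · intro a ha b hb
    simp only [Finset.mem_preimage, Prod.map_apply, id]
    exact ⟨hex' a ha b hb, fun ⟨i, j, h1, h2, h3⟩ => (huniq a _ _ b h1 h2 h3).1⟩
  · intro a ha b hb hab
    simp only [Finset.mem_preimage, Prod.map_apply, id]
    obtain ⟨i, j, h1, h2, h3⟩ := hex' a ha b hb hab
    refine ⟨(i, j), ⟨h1, h2, h3⟩, fun w hw => ?_⟩
    obtain ⟨hi, hj⟩ := (huniq a _ _ b h1 h2 h3).2 _ _ hw.1 hw.2.1 hw.2.2
    exact Prod.ext (he hi) (hd hj)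
  · have h1 := Finset.card_le_card_of_injOn (s := E1.preimage _ hmap1.injOn) (t := E1) _
      (fun p hp => Finset.mem_preimage.1 hp) hmap1.injOn
    have h2 := Finset.card_le_card_of_injOn (s := E2.preimage _ hmap2.injOn) (t := E2) _
      (fun p hp => Finset.mem_preimage.1 hp) hmap2.injOn
    have h3 := Finset.card_le_card_of_injOn (s := E3.preimage _ hmap3.injOn) (t := E3) _
      (fun p hp => Finset.mem_preimage.1 hp) hmap3.injOn
    omega

end HasDepth3Fact

/-- Block sizes of the hierarchical decomposition: a block of size `M * (M + 1)` consists of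
`M + 1` blocks of size `M`. -/
def blockSize : ℕ → ℕ
  | 0 => 1
  | k + 1 => blockSize k * (blockSize k + 1)

theorem blockSize_pos (k : ℕ) : 0 < blockSize k := by
  induction k with
  | zero => simp [blockSize]
  | succ k ih => simp [blockSize, ih]

theorem two_pow_two_pow_le_blockSize (k : ℕ) : 2 ^ 2 ^ k ≤ blockSize (k + 1) := by
  induction k with
  | zero => simp [blockSize]
  | succ k ih =>
    calc 2 ^ 2 ^ (k + 1) = 2 ^ 2 ^ k * 2 ^ 2 ^ k := by rw [← pow_add, pow_succ, mul_two]
      _ ≤ blockSize (k + 1) * (blockSize (k + 1) + 1) :=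
        Nat.mul_le_mul ih (ih.trans (Nat.le_succ _))

/-- Edges between blocks of size `M` lying in a common block of size `M * (M + 1)`: as the last
of the `M + 1` blocks is never the smaller one, there are no more edges than positions. -/
theorem exists_blockEdges {κ : Type} (P : Finset (κ × ℕ))
    (hP : ∀ c r r', (c, r) ∈ P → r' ≤ r → (c, r') ∈ P) {M : ℕ} (hM : 0 < M) :
    ∃ E : Finset ((κ × ℕ) × (κ × ℕ)), E.card ≤ P.card ∧ ∀ p ∈ P, ∀ q ∈ P,
      (((p.1, p.2 / M), (q.1, q.2 / M)) ∈ E ↔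
        p.1 = q.1 ∧ p.2 / M < q.2 / M ∧ p.2 / M / (M + 1) = q.2 / M / (M + 1)) := by
  classical
  refine ⟨(P.image fun p => ((p.1, (p.2 / M + 1) / (M + 1) * (M + 1) + p.2 % M),
      (p.1, p.2 / M + 1))).filter fun w => w.1.2 < w.2.2,
    (Finset.card_filter_le _ _).trans Finset.card_image_le, ?_⟩
  rintro ⟨c, r⟩ - ⟨c', r'⟩ hq
  simp only [Finset.mem_filter, Finset.mem_image, Prod.mk.injEq, Prod.exists]
  constructor
  · rintro ⟨⟨d, k, -, ⟨rfl, hu⟩, rfl, hv⟩, hlt⟩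
    refine ⟨rfl, hlt, ?_⟩
    rw [← hu, ← hv, mul_comm, Nat.mul_add_div (Nat.succ_pos M),
      Nat.div_eq_of_lt ((Nat.mod_lt k hM).trans (Nat.lt_succ_self M)), add_zero]
  · rintro ⟨rfl, hlt, hpar⟩
    generalize hu : r / M = u at *
    obtain ⟨v, hv⟩ : ∃ v, r' / M = v + 1 := ⟨r' / M - 1, by omega⟩
    rw [hv] at hlt hpar ⊢
    have hu' := Nat.div_add_mod u (M + 1)
    have hv' := Nat.div_add_mod (v + 1) (M + 1)
    have hmod := Nat.mod_lt (v + 1) M.succ_pos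
    rw [Nat.succ_eq_add_one] at hmod
    rw [hpar] at hu'
    have hlt' : u % (M + 1) < M := by omega
    have hr' : (v + 1) * M ≤ r' := hv ▸ Nat.div_mul_le_self r' M
    have hdiv : (M * v + u % (M + 1)) / M = v := by
      rw [Nat.mul_add_div hM, Nat.div_eq_of_lt hlt', add_zero]
    have hrem : (M * v + u % (M + 1)) % M = u % (M + 1) := by
      rw [Nat.mul_add_mod, Nat.mod_eq_of_lt hlt']
    refine ⟨⟨c, M * v + u % (M + 1), hP c r' _ hq (by nlinarith), ⟨rfl, ?_⟩, rfl, ?_⟩, hlt⟩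
    · rw [hdiv, hrem, mul_comm]
      exact hu'
    · rw [hdiv]

/-- Comparisons within a common block at level `L`. -/
theorem HasDepth3Fact.lt_within_block {α β : Type*} {κ : Type} (A : Finset α) (B : Finset β)
    (P : Finset (κ × ℕ)) (hP : ∀ c r r', (c, r) ∈ P → r' ≤ r → (c, r') ∈ P)
    (f : α → κ × ℕ) (g : β → κ × ℕ) (hf : ∀ a ∈ A, f a ∈ P) (hg : ∀ b ∈ B, g b ∈ P) (L : ℕ) :
    HasDepth3Fact A B (fun a b => (f a).1 = (g b).1 ∧ (f a).2 < (g b).2 ∧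
      (f a).2 / blockSize L = (g b).2 / blockSize L) (L * (A.card + P.card + B.card)) := by
  induction L with
  | zero =>
    rw [zero_mul]
    refine .of_forall_not fun a b h => ?_
    simp only [blockSize, Nat.div_one] at h
    omega
  | succ L ih =>
    obtain ⟨E, hE, hmem⟩ := exists_blockEdges P hP (blockSize_pos L)
    have hlevel := (HasDepth3Fact.of_maps A B (fun a => ((f a).1, (f a).2 / blockSize L))
      (fun b => ((g b).1, (g b).2 / blockSize L)) E).congr
      fun a ha b hb => hmem _ (hf a ha) _ (hg b hb)
    refine ((ih.or hlevel ?_).congr ?_).mono ?_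
    · rintro a b ⟨-, -, h⟩ ⟨-, h', -⟩
      exact h'.ne h
    · intro a _ b _
      simp only [blockSize, ← Nat.div_div_eq_div_mul]
      constructor
      · rintro (⟨h1, h2, h3⟩ | ⟨h1, h2, h3⟩)
        · exact ⟨h1, h2, by rw [h3]⟩
        · exact ⟨h1, lt_of_not_ge fun h => h2.not_ge (Nat.div_le_div_right h), h3⟩
      · rintro ⟨h1, h2, h3⟩
        rcases (Nat.div_le_div_right (c := blockSize L) h2.le).eq_or_lt with h | h
        · exact .inl ⟨h1, h2, h⟩
        · exact .inr ⟨h1, h, h3⟩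
    · rw [Nat.succ_mul]
      omega

/-- Comparison of real keys within the fibres of `cell`. -/
theorem HasDepth3Fact.lt_within_fibre {α β : Type*} {κ : Type} (A : Finset α) (B : Finset β)
    (k : α → ℝ) (k' : β → ℝ) (cell : ℝ → κ) {L : ℕ} (hL : A.card + B.card ≤ blockSize L) :
    HasDepth3Fact A B (fun a b => cell (k a) = cell (k' b) ∧ k a < k' b)
      (2 * L * (A.card + B.card)) := by
  classical
  let T : Finset ℝ := A.image k ∪ B.image k'
  have hT : T.card ≤ A.card + B.card :=
    (Finset.card_union_le _ _).trans (add_le_add Finset.card_image_le Finset.card_image_le)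
  let fibre : κ → Finset ℝ := fun c => T.filter fun t => cell t = c
  let P : Finset (κ × ℕ) :=
    (T.image cell).biUnion fun c => (Finset.range (fibre c).card).image fun r => (c, r)
  let pos : ℝ → κ × ℕ := fun t => (cell t, ((fibre (cell t)).filter (· < t)).card)
  have hmemP : ∀ c r, (c, r) ∈ P ↔ c ∈ T.image cell ∧ r < (fibre c).card := by
    intro c r
    simp only [P, Finset.mem_biUnion, Finset.mem_image (s := Finset.range _), Finset.mem_range,
      Prod.mk.injEq]
    constructor
    · rintro ⟨_, hc, _, hr, rfl, rfl⟩
      exact ⟨hc, hr⟩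
    · rintro ⟨hc, hr⟩
      exact ⟨c, hc, r, hr, rfl, rfl⟩
  have hPcard : P.card ≤ T.card := by
    rw [Finset.card_eq_sum_card_image cell T]
    exact Finset.card_biUnion_le.trans
      (Finset.sum_le_sum fun c _ => Finset.card_image_le.trans (Finset.card_range _).le)
  have hpos : ∀ t ∈ T, pos t ∈ P := by
    intro t ht
    refine (hmemP _ _).2 ⟨Finset.mem_image_of_mem cell ht, Finset.card_lt_card ?_⟩
    exact Finset.filter_ssubset.2 ⟨t, by simp [fibre, ht], lt_irrefl t⟩
  have hlt : ∀ t ∈ T, ∀ t', cell t = cell t' → ((pos t).2 < (pos t').2 ↔ t < t') := by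
    intro t ht t' hc
    simp only [pos, ← hc]
    constructor
    · intro h
      by_contra! h'
      exact h.not_ge (Finset.card_le_card fun x hx => by
        simp only [Finset.mem_filter] at hx ⊢
        exact ⟨hx.1, hx.2.trans_le h'⟩)
    · intro h
      refine Finset.card_lt_card ((Finset.ssubset_iff_of_subset fun x hx => ?_).2 ⟨t, ?_, ?_⟩)
      · simp only [Finset.mem_filter] at hx ⊢
        exact ⟨hx.1, hx.2.trans h⟩
      · simp [fibre, ht, h]
      · simp
  have hkT : ∀ a ∈ A, k a ∈ T := fun a ha =>
    Finset.mem_union_left _ (Finset.mem_image_of_mem k ha)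
  have hkT' : ∀ b ∈ B, k' b ∈ T := fun b hb =>
    Finset.mem_union_right _ (Finset.mem_image_of_mem k' hb)
  have hdiv : ∀ t ∈ T, (pos t).2 / blockSize L = 0 := fun t ht =>
    Nat.div_eq_of_lt ((((hmemP _ _).1 (hpos t ht)).2.trans_le
      (Finset.card_le_card (Finset.filter_subset _ _))).trans_le (hT.trans hL))
  refine ((HasDepth3Fact.lt_within_block A B P (fun c r r' h hr => ?_) (fun a => pos (k a))
    (fun b => pos (k' b)) (fun a ha => hpos _ (hkT a ha)) (fun b hb => hpos _ (hkT' b hb))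
    L).congr fun a ha b hb => ?_).mono ?_
  · rw [hmemP] at h ⊢
    exact ⟨h.1, hr.trans_lt h.2⟩
  · rw [hdiv _ (hkT a ha), hdiv _ (hkT' b hb)]
    refine and_congr_right fun hc => ?_
    rw [hlt _ (hkT a ha) _ hc]
    simp
  · calc L * (A.card + P.card + B.card) ≤ L * (2 * (A.card + B.card)) :=
        Nat.mul_le_mul_left _ (by omega)
      _ = 2 * L * (A.card + B.card) := by ring

/-- Cut the line into cells of length `ε`: two points are at distance less than `ε` iff they share
a cell, or they lie in adjacent cells and satisfy a single inequality. -/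
theorem abs_sub_lt_iff_floor {ε : ℝ} (hε : 0 < ε) (a b : ℝ) :
    |a - b| < ε ↔ (⌊a / ε⌋ = ⌊b / ε⌋ ∨ (⌊(a - ε) / ε⌋ = ⌊b / ε⌋ ∧ a - ε < b)) ∨
      (⌊a / ε⌋ = ⌊(b - ε) / ε⌋ ∧ b - ε < a) := by
  have hsub : ∀ x : ℝ, ⌊(x - ε) / ε⌋ = ⌊x / ε⌋ - 1 := fun x => by
    rw [sub_div, div_self hε.ne', Int.floor_sub_one]
  rw [hsub, hsub]
  obtain ⟨x, rfl⟩ : ∃ x, a = x * ε := ⟨a / ε, by field_simp⟩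
  obtain ⟨y, rfl⟩ : ∃ y, b = y * ε := ⟨b / ε, by field_simp⟩
  rw [mul_div_cancel_right₀ _ hε.ne', mul_div_cancel_right₀ _ hε.ne', ← sub_mul, abs_mul,
    abs_of_pos hε, mul_lt_iff_lt_one_left hε, ← sub_one_mul, ← sub_one_mul,
    mul_lt_mul_iff_left₀ hε, mul_lt_mul_iff_left₀ hε, abs_lt]
  have hx := Int.floor_le x
  have hx' := Int.lt_floor_add_one x
  have hy := Int.floor_le y
  have hy' := Int.lt_floor_add_one y
  constructor
  · rintro ⟨h1, h2⟩
    have h3 : ⌊x⌋ < ⌊y⌋ + 2 := by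
      have : (⌊x⌋ : ℝ) < ⌊y⌋ + 2 := by linarith
      exact_mod_cast this
    have h4 : ⌊y⌋ < ⌊x⌋ + 2 := by
      have : (⌊y⌋ : ℝ) < ⌊x⌋ + 2 := by linarith
      exact_mod_cast this
    rcases lt_trichotomy ⌊x⌋ ⌊y⌋ with h | h | h
    · exact .inr ⟨by omega, by linarith⟩
    · exact .inl (.inl h)
    · exact .inl (.inr ⟨by omega, by linarith⟩)
  · rintro ((h | ⟨h, h'⟩) | ⟨h, h'⟩)
    · rw [h] at hx hx'
      constructor <;> linarith
    · have : (⌊x⌋ : ℝ) - 1 = ⌊y⌋ := by exact_mod_cast h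
      constructor <;> linarith
    · have : (⌊x⌋ : ℝ) = ⌊y⌋ - 1 := by exact_mod_cast h
      constructor <;> linarith

theorem HasDepth3Fact.abs_sub_lt {ε : ℝ} (hε : 0 < ε) (A B : Finset ℝ) {L : ℕ}
    (hL : A.card + B.card ≤ blockSize L) :
    HasDepth3Fact A B (fun a b => |a - b| < ε) ((4 * L + 2) * (A.card + B.card)) := by
  classical
  have hsub : ∀ x : ℝ, ⌊(x - ε) / ε⌋ = ⌊x / ε⌋ - 1 := fun x => by
    rw [sub_div, div_self hε.ne', Int.floor_sub_one]
  have hsame := (HasDepth3Fact.of_maps A B (fun a : ℝ => ⌊a / ε⌋) (fun b : ℝ => ⌊b / ε⌋)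
    (A.image fun a => (⌊a / ε⌋, ⌊a / ε⌋))).congr
    (S := fun a b => ⌊a / ε⌋ = ⌊b / ε⌋) fun a ha b _ => by
      simp only [Finset.mem_image, Prod.mk.injEq]
      exact ⟨fun ⟨_, _, h1, h2⟩ => h1.symm.trans h2, fun h => ⟨a, ha, rfl, h⟩⟩
  have hbelow := HasDepth3Fact.lt_within_fibre A B (fun a => a - ε) (fun b => b)
    (fun t => ⌊t / ε⌋) hL
  have habove := (HasDepth3Fact.lt_within_fibre A B (fun a => -a) (fun b => -(b - ε))
    (fun t => ⌊-t / ε⌋) hL).congr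
    (S := fun a b => ⌊a / ε⌋ = ⌊(b - ε) / ε⌋ ∧ b - ε < a) fun a _ b _ => by
      simp only [neg_neg, neg_lt_neg_iff]
  refine (((hsame.or hbelow ?_).or habove ?_).congr fun a _ b _ =>
    (abs_sub_lt_iff_floor hε a b).symm).mono ?_
  · rintro a b h ⟨h', -⟩
    rw [hsub] at h'
    omega
  · rintro a b (h | ⟨h, -⟩) ⟨h', -⟩ <;> rw [hsub] at * <;> omega
  · have hcard : (A.image fun a => (⌊a / ε⌋, ⌊a / ε⌋)).card ≤ A.card := Finset.card_image_le
    nlinarith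

theorem exists_blockSize_ge (n : ℕ) :
    ∃ L : ℕ, n ≤ blockSize L ∧ (L : ℝ) ≤ 2 + Real.logb 2 (1 + Real.logb 2 n) := by
  refine ⟨Nat.log 2 (Nat.log 2 n + 1) + 1 + 1, ?_, ?_⟩
  · calc n ≤ 2 ^ (Nat.log 2 n + 1) := (Nat.lt_pow_succ_log_self one_lt_two n).le
      _ ≤ 2 ^ 2 ^ (Nat.log 2 (Nat.log 2 n + 1) + 1) :=
        Nat.pow_le_pow_right two_pos (Nat.lt_pow_succ_log_self one_lt_two _).le
      _ ≤ _ := two_pow_two_pow_le_blockSize _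
  · have h1 : (Nat.log 2 n : ℝ) ≤ Real.logb 2 n := by
      exact_mod_cast Real.natLog_le_logb n 2
    have h2 : (Nat.log 2 (Nat.log 2 n + 1) : ℝ) ≤ Real.logb 2 ((Nat.log 2 n + 1 : ℕ) : ℝ) := by
      exact_mod_cast Real.natLog_le_logb (Nat.log 2 n + 1) 2
    have h3 : Real.logb 2 ((Nat.log 2 n + 1 : ℕ) : ℝ) ≤ Real.logb 2 (1 + Real.logb 2 n) :=
      Real.logb_le_logb_of_le one_lt_two (by positivity) (by push_cast; linarith)
    push_cast
    linarith

/-- Factorization of a band predicate: there is an absolute constant `C` such that for every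
`ε > 0` and all `A, B ⊆ ℝ` with `|A| + |B| = n ≥ 2`, the relation `{(a,b) : |a − b| < ε}`
admits a duplicate-free depth-3 factorization of size at most `C · n · (1 + log₂(1 + log₂ n))`. -/
theorem band_depth3_factorization :
    ∃ C : ℝ, ∀ ε : ℝ, 0 < ε → ∀ (A B : Finset ℝ) (n : ℕ), A.card + B.card = n → 2 ≤ n →
      ∃ (x y : ℕ) (E1 : Finset (ℝ × Fin x)) (E2 : Finset (Fin x × Fin y))
        (E3 : Finset (Fin y × ℝ)),
        IsDepth3Fact A B (fun a b => |a - b| < ε) E1 E2 E3 ∧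
        IsDupFree A B (fun a b => |a - b| < ε) E1 E2 E3 ∧
        ((E1.card : ℝ) + (E2.card : ℝ) + (E3.card : ℝ)) ≤
          C * n * (1 + Real.logb 2 (1 + Real.logb 2 n)) := by
  refine ⟨10, fun ε hε A B n hn hn2 => ?_⟩
  obtain ⟨L, hnL, hL⟩ := exists_blockSize_ge n
  obtain ⟨x, y, E1, E2, E3, hfact, hdup, hs⟩ :=
    (HasDepth3Fact.abs_sub_lt hε A B (hn.trans_le hnL)).exists_fin
  refine ⟨x, y, E1, E2, E3, hfact, hdup, ?_⟩
  rw [hn] at hs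
  have hs' : (E1.card : ℝ) + E2.card + E3.card ≤ (4 * L + 2) * n := by exact_mod_cast hs
  have hn1 : (1 : ℝ) ≤ n := by exact_mod_cast (by omega : 1 ≤ n)
  have hlog : 0 ≤ Real.logb 2 (1 + Real.logb 2 n) :=
    Real.logb_nonneg one_lt_two (le_add_of_nonneg_right (Real.logb_nonneg one_lt_two hn1))
  calc (E1.card : ℝ) + E2.card + E3.card ≤ (4 * L + 2) * n := hs'
    _ ≤ (10 * (1 + Real.logb 2 (1 + Real.logb 2 n))) * n := by gcongr; linarith
    _ = 10 * n * (1 + Real.logb 2 (1 + Real.logb 2 n)) := by ring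
end

section
/- Let ε > 0, m ∈ ℕ, and s₁ < s₂ < … < s_m be real numbers with s_{j+1} − s_j > ε for all 1 ≤ j < m. Then for every real number a, the number of indices j ∈ {1,…,m} such that the closed interval [s_j, s_j + ε] intersects the open interval (a − ε, a + ε) is at most 3. -/
/-- If consecutive values of `s` differ by at least `ε`, then values whose indices are `k` apart
differ by at least `k * ε`. -/
theorem natCast_mul_le_sub_of_gap {ε : ℝ} {m : ℕ} {s : Fin m → ℝ}
    (hgap : ∀ (j : ℕ) (hj : j + 1 < m),
      ε ≤ s ⟨j + 1, hj⟩ - s ⟨j, Nat.lt_of_succ_lt hj⟩)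
    (i k : ℕ) (h : i + k < m) :
    k * ε ≤ s ⟨i + k, h⟩ - s ⟨i, by omega⟩ := by
  induction k with
  | zero => simp
  | succ k ih =>
    have h₁ := ih (by omega)
    have h₂ := hgap (i + k) h
    push_cast
    simp only [← add_assoc]
    linarith

/-- A set of indices that are pairwise less than `n` apart has at most `n` elements. -/
theorem Fin.card_le_of_lt_add {m n : ℕ} (t : Finset (Fin m))
    (h : ∀ i ∈ t, ∀ j ∈ t, (j : ℕ) < i + n) : t.card ≤ n := by
  rcases t.eq_empty_or_nonempty with rfl | ht
  · simp
  · have hsub : t.map Fin.valEmbedding ⊆ Finset.Ico (t.min' ht : ℕ) (t.min' ht + n) := by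
      intro x hx
      obtain ⟨j, hj, rfl⟩ := Finset.mem_map.1 hx
      exact Finset.mem_Ico.2 ⟨t.min'_le j hj, h _ (t.min'_mem ht) j hj⟩
    simpa using Finset.card_le_card hsub

/-- In the band-join grouping, if group start values `s 0 < s 1 < … < s (m-1)` satisfy
`s (j+1) - s j > ε`, then for any source value `a`, at most `3` of the intervals
`[s j, s j + ε]` intersect the open interval `(a - ε, a + ε)`. -/
theorem band_groups_at_most_three (ε : ℝ) (hε : 0 < ε) (m : ℕ) (s : Fin m → ℝ)
    (hgap : ∀ (j : ℕ) (hj : j + 1 < m),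
      ε < s ⟨j + 1, hj⟩ - s ⟨j, Nat.lt_of_succ_lt hj⟩)
    (a : ℝ) :
    Nat.card {j : Fin m //
      (Set.Icc (s j) (s j + ε) ∩ Set.Ioo (a - ε) (a + ε)).Nonempty} ≤ 3 := by
  classical
  rw [Nat.card_eq_fintype_card, Fintype.card_subtype]
  refine Fin.card_le_of_lt_add _ fun i hi j hj => ?_
  obtain ⟨x, ⟨-, hx⟩, hax, -⟩ := (Finset.mem_filter.1 hi).2
  obtain ⟨y, ⟨hy, -⟩, -, hya⟩ := (Finset.mem_filter.1 hj).2
  by_contra! hij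
  obtain ⟨k, hk⟩ := Nat.exists_eq_add_of_le (show (i : ℕ) ≤ j by omega)
  have hs := natCast_mul_le_sub_of_gap (fun j hj => (hgap j hj).le) i k (hk ▸ j.isLt)
  have hj' : (⟨i + k, hk ▸ j.isLt⟩ : Fin m) = j := Fin.ext hk.symm
  rw [hj'] at hs
  have hk3 : (3 : ℝ) ≤ k := by exact_mod_cast (show 3 ≤ k by omega)
  have := mul_le_mul_of_nonneg_right hk3 hε.le
  simp only [Fin.eta] at hs
  linarith
end

section
/- For all finite sets A, B of real numbers with |A| + |B| = n, there exist m ≤ n, a partial map assigning to each a ∈ A at most one index f(a) ∈ {1,…,m}, and a partial map assigning to each b ∈ B at most one index g(b) ∈ {1,…,m}, such that for all a ∈ A and b ∈ B: a < b if and only if f(a) and g(b) are both defined and f(a) ≤ g(b). Consequently, the layered graph with source nodes A, chain nodes v₁ → v₂ → … → v_m, target nodes B, an edge a → v_{f(a)} whenever f(a) is defined, and an edge v_{g(b)} → b whenever g(b) is defined, has at most 2n − 1 edges, has exactly one directed path from a to b when a < b and none otherwise, and its longest path has length at most m + 1. -/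
/-- The adjacency relation of the shared-ranges layered graph: source nodes `A` (left summand),
chain nodes `v_1 → … → v_m` (middle summand `Fin m`), target nodes `B` (right summand).
There is an edge `a → v_{f a}` whenever `f a` is defined, chain edges `v_i → v_{i+1}`, and an
edge `v_{g b} → b` whenever `g b` is defined. -/
def chainAdj (A B : Finset ℝ) {m : ℕ} (f g : ℝ → Option (Fin m)) :
    ℝ ⊕ Fin m ⊕ ℝ → ℝ ⊕ Fin m ⊕ ℝ → Prop
  | Sum.inl a, Sum.inr (Sum.inl i) => a ∈ A ∧ f a = some i
  | Sum.inr (Sum.inl i), Sum.inr (Sum.inl j) => (j : ℕ) = (i : ℕ) + 1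
  | Sum.inr (Sum.inl i), Sum.inr (Sum.inr b) => b ∈ B ∧ g b = some i
  | _, _ => False

namespace SharedRanges

variable {A B : Finset ℝ} {m : ℕ} {f g : ℝ → Option (Fin m)}

/-- The layer of a node: sources are at `0`, `v_i` at `i + 1`, targets at `m + 1`. -/
def layer (m : ℕ) : ℝ ⊕ Fin m ⊕ ℝ → ℕ
  | Sum.inl _ => 0
  | Sum.inr (Sum.inl i) => i + 1
  | Sum.inr (Sum.inr _) => m + 1

theorem layer_le (x : ℝ ⊕ Fin m ⊕ ℝ) : layer m x ≤ m + 1 := by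
  rcases x with a | i | b <;> simp only [layer] <;> omega

theorem layer_lt_of_chainAdj {x y : ℝ ⊕ Fin m ⊕ ℝ} (h : chainAdj A B f g x y) :
    layer m x < layer m y := by
  rcases x with a | i | b <;> rcases y with a' | j | b' <;>
    simp only [chainAdj, layer] at h ⊢ <;> omega

theorem layer_add_length_le (l : List (ℝ ⊕ Fin m ⊕ ℝ)) (x : ℝ ⊕ Fin m ⊕ ℝ)
    (h : List.IsChain (chainAdj A B f g) (x :: l)) : layer m x + l.length ≤ m + 1 := by
  induction l generalizing x with
  | nil => simpa using layer_le x
  | cons y l ih =>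
    rw [List.isChain_cons_cons] at h
    have := layer_lt_of_chainAdj h.1
    have := ih y h.2
    simp only [List.length_cons]
    omega

theorem length_le_of_isChain {l : List (ℝ ⊕ Fin m ⊕ ℝ)}
    (h : List.IsChain (chainAdj A B f g) l) : l.length ≤ m + 2 := by
  cases l with
  | nil => simp
  | cons x l =>
    have := layer_add_length_le l x h
    simp only [List.length_cons]
    omega

theorem exists_index_of_isChain {b : ℝ} (l : List (ℝ ⊕ Fin m ⊕ ℝ)) (i : Fin m)
    (h : List.IsChain (chainAdj A B f g) (Sum.inr (Sum.inl i) :: (l ++ [Sum.inr (Sum.inr b)]))) :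
    ∃ j : Fin m, g b = some j ∧ (j : ℕ) = i + l.length := by
  induction l generalizing i with
  | nil =>
    simp only [List.nil_append, List.isChain_cons_cons, chainAdj] at h
    exact ⟨i, h.1.2, by simp⟩
  | cons y l ih =>
    rw [List.cons_append, List.isChain_cons_cons] at h
    obtain ⟨h1, h2⟩ := h
    rcases y with a | k | c
    · simp [chainAdj] at h1
    · obtain ⟨j, hj, hjk⟩ := ih k h2
      simp only [chainAdj] at h1
      refine ⟨j, hj, ?_⟩
      simp only [List.length_cons]
      omega
    · cases l <;> simp [chainAdj] at h2

theorem eq_of_isChain_of_length_eq {b : ℝ} (l l' : List (ℝ ⊕ Fin m ⊕ ℝ)) (i : Fin m)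
    (hl : l.length = l'.length)
    (h : List.IsChain (chainAdj A B f g) (Sum.inr (Sum.inl i) :: (l ++ [Sum.inr (Sum.inr b)])))
    (h' : List.IsChain (chainAdj A B f g) (Sum.inr (Sum.inl i) :: (l' ++ [Sum.inr (Sum.inr b)]))) :
    l = l' := by
  induction l generalizing i l' with
  | nil => exact (List.length_eq_zero_iff.mp hl.symm).symm
  | cons y l ih =>
    cases l' with
    | nil => simp at hl
    | cons y' l' =>
      rw [List.cons_append, List.isChain_cons_cons] at h h'
      obtain ⟨h1, h2⟩ := h
      obtain ⟨h1', h2'⟩ := h'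
      rcases y with a | k | c
      · simp [chainAdj] at h1
      · rcases y' with a | k' | c
        · simp [chainAdj] at h1'
        · simp only [chainAdj] at h1 h1'
          obtain rfl : k = k' := Fin.ext (h1.trans h1'.symm)
          rw [ih l' k (by simpa using hl) h2 h2']
        · cases l' <;> simp [chainAdj] at h2'
      · cases l <;> simp [chainAdj] at h2

theorem exists_isChain_of_add_eq {b : ℝ} (hb : b ∈ B) {j : Fin m} (hj : g b = some j) (d : ℕ)
    (i : Fin m) (hd : (i : ℕ) + d = j) : ∃ l : List (ℝ ⊕ Fin m ⊕ ℝ),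
      List.IsChain (chainAdj A B f g)
        (Sum.inr (Sum.inl i) :: (l ++ [Sum.inr (Sum.inr b)])) := by
  induction d generalizing i with
  | zero =>
    obtain rfl : i = j := Fin.ext hd
    exact ⟨[], by simp [chainAdj, hb, hj]⟩
  | succ d ih =>
    obtain ⟨l, hl⟩ := ih ⟨i + 1, by omega⟩ (by simp only; omega)
    refine ⟨Sum.inr (Sum.inl ⟨i + 1, by omega⟩) :: l, ?_⟩
    rw [List.cons_append, List.isChain_cons_cons]
    exact ⟨by simp [chainAdj], hl⟩

/-- A path from a source to a target starts by entering the chain. -/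
theorem exists_cons_of_isChain {a b : ℝ} {l : List (ℝ ⊕ Fin m ⊕ ℝ)}
    (h : List.IsChain (chainAdj A B f g) (Sum.inl a :: (l ++ [Sum.inr (Sum.inr b)]))) :
    ∃ (i : Fin m) (l' : List (ℝ ⊕ Fin m ⊕ ℝ)), l = Sum.inr (Sum.inl i) :: l' ∧ f a = some i ∧
      List.IsChain (chainAdj A B f g)
        (Sum.inr (Sum.inl i) :: (l' ++ [Sum.inr (Sum.inr b)])) := by
  cases l with
  | nil => simp [chainAdj] at h
  | cons y l =>
    rw [List.cons_append, List.isChain_cons_cons] at h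
    obtain ⟨h1, h2⟩ := h
    rcases y with a' | i | c
    · simp [chainAdj] at h1
    · exact ⟨i, l, rfl, h1.2, h2⟩
    · simp [chainAdj] at h1

theorem exists_isChain_iff {a b : ℝ} (ha : a ∈ A) (hb : b ∈ B) :
    (∃ l : List (ℝ ⊕ Fin m ⊕ ℝ),
      List.IsChain (chainAdj A B f g) (Sum.inl a :: (l ++ [Sum.inr (Sum.inr b)]))) ↔
    ∃ i j : Fin m, f a = some i ∧ g b = some j ∧ i ≤ j := by
  constructor
  · rintro ⟨l, hl⟩
    obtain ⟨i, l', -, hi, hl'⟩ := exists_cons_of_isChain hl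
    obtain ⟨j, hj, hij⟩ := exists_index_of_isChain l' i hl'
    exact ⟨i, j, hi, hj, Fin.le_def.mpr (by omega)⟩
  · rintro ⟨i, j, hi, hj, hij⟩
    rw [Fin.le_def] at hij
    obtain ⟨l, hl⟩ := exists_isChain_of_add_eq (A := A) (f := f) hb hj (j - i) i (by omega)
    refine ⟨Sum.inr (Sum.inl i) :: l, ?_⟩
    rw [List.cons_append, List.isChain_cons_cons]
    exact ⟨⟨ha, hi⟩, hl⟩

theorem isChain_unique {a b : ℝ} {l l' : List (ℝ ⊕ Fin m ⊕ ℝ)}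
    (h : List.IsChain (chainAdj A B f g) (Sum.inl a :: (l ++ [Sum.inr (Sum.inr b)])))
    (h' : List.IsChain (chainAdj A B f g) (Sum.inl a :: (l' ++ [Sum.inr (Sum.inr b)]))) :
    l = l' := by
  obtain ⟨i, k, rfl, hi, hk⟩ := exists_cons_of_isChain h
  obtain ⟨i', k', rfl, hi', hk'⟩ := exists_cons_of_isChain h'
  obtain rfl : i = i' := Option.some.inj (hi.symm.trans hi')
  obtain ⟨j, hj, hjk⟩ := exists_index_of_isChain k i hk
  obtain ⟨j', hj', hjk'⟩ := exists_index_of_isChain k' i hk'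
  obtain rfl : j = j' := Option.some.inj (hj.symm.trans hj')
  rw [eq_of_isChain_of_length_eq k k' i (by omega) hk hk']

open Classical in
theorem exists_edgeFinset (A B : Finset ℝ) (f g : ℝ → Option (Fin m)) :
    ∃ E : Finset ((ℝ ⊕ Fin m ⊕ ℝ) × (ℝ ⊕ Fin m ⊕ ℝ)),
      (∀ e, chainAdj A B f g e.1 e.2 ↔ e ∈ E) ∧ E.card ≤ A.card + B.card + (m - 1) := by
  let node : Option (Fin m) → ℝ ⊕ Fin m ⊕ ℝ := fun o => o.elim (Sum.inl 0) (Sum.inr ∘ Sum.inl)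
  let index : ℕ → Option (Fin m) := fun k => if h : k < m then some ⟨k, h⟩ else none
  let S : Finset ((ℝ ⊕ Fin m ⊕ ℝ) × (ℝ ⊕ Fin m ⊕ ℝ)) :=
    A.image (fun a => (Sum.inl a, node (f a))) ∪
    B.image (fun b => (node (g b), Sum.inr (Sum.inr b))) ∪
    (Finset.range (m - 1)).image (fun k => (node (index k), node (index (k + 1))))
  refine ⟨S.filter fun e => chainAdj A B f g e.1 e.2, fun e => ?_, ?_⟩
  · rw [Finset.mem_filter, iff_and_self]
    intro h
    obtain ⟨x, y⟩ := e
    simp only [S, Finset.mem_union, Finset.mem_image]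
    rcases x with a | i | b <;> rcases y with a' | j | b' <;> simp only [chainAdj] at h
    · exact Or.inl (Or.inl ⟨a, h.1, by simp [node, h.2]⟩)
    · refine Or.inr ⟨i, Finset.mem_range.mpr (by omega), ?_⟩
      have hi : index i = some i := by simp [index]
      have hj : index (i + 1) = some j := by rw [← h]; simp [index]
      simp [node, hi, hj]
    · exact Or.inl (Or.inr ⟨b', h.1, by simp [node, h.2]⟩)
  · refine (Finset.card_filter_le _ _).trans <| (Finset.card_union_le _ _).trans <|
      add_le_add ((Finset.card_union_le _ _).trans <|
        add_le_add Finset.card_image_le Finset.card_image_le) ?_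
    exact Finset.card_image_le.trans (Finset.card_range _).le

theorem lt_iff_card_filter_lt {a b : ℝ} (ha : a ∈ A) :
    a < b ↔ (A.filter (· < a)).card < (A.filter (· < b)).card := by
  constructor
  · intro h
    refine Finset.card_lt_card (Finset.ssubset_iff_of_subset ?_ |>.mpr ⟨a, by simp [ha, h], by simp⟩)
    exact Finset.monotone_filter_right A fun x _ hx => lt_trans hx h
  · intro h
    by_contra! hba
    exact h.not_ge <| Finset.card_le_card <|
      Finset.monotone_filter_right A fun x _ hx => lt_of_lt_of_le hx hba

theorem exists_indices (A : Finset ℝ) :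
    ∃ f g : ℝ → Option (Fin A.card), ∀ a ∈ A, ∀ b,
      (a < b ↔ ∃ i j : Fin A.card, f a = some i ∧ g b = some j ∧ i ≤ j) := by
  let c : ℝ → ℕ := fun x => (A.filter (· < x)).card
  have hc : ∀ x, c x ≤ A.card := fun x => Finset.card_filter_le _ _
  refine ⟨fun a => if h : c a < A.card then some ⟨c a, h⟩ else none,
    fun b => if h : 0 < c b then some ⟨c b - 1, by have := hc b; omega⟩ else none,
    fun a ha b => ?_⟩
  have key : a < b ↔ c a < c b := lt_iff_card_filter_lt ha
  rw [key]
  constructor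
  · intro h
    have hb := hc b
    exact ⟨⟨c a, by omega⟩, ⟨c b - 1, by omega⟩, dif_pos (by omega), dif_pos (by omega),
      Fin.le_def.mpr (by simp only; omega)⟩
  · rintro ⟨i, j, hi, hj, hij⟩
    simp only [Option.dite_none_right_eq_some, Option.some.injEq] at hi hj
    obtain ⟨_, rfl⟩ := hi
    obtain ⟨_, rfl⟩ := hj
    simp only [Fin.mk_le_mk] at hij
    omega

end SharedRanges

/-- Shared-ranges construction for a single inequality: there are `m ≤ n` chain nodes and
partial index maps `f` on `A` and `g` on `B` with `a < b` iff both indices are defined and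
`f a ≤ g b`. Consequently the associated layered chain graph has at most `2n - 1` edges,
exactly one directed path from `a` to `b` when `a < b` and none otherwise, and its longest
path has length at most `m + 1` (i.e., at most `m + 2` vertices). -/
theorem shared_ranges_construction (A B : Finset ℝ) (n : ℕ) (hn : A.card + B.card = n) :
    ∃ (m : ℕ) (f g : ℝ → Option (Fin m)),
      m ≤ n ∧
      (∀ a ∈ A, ∀ b ∈ B,
        (a < b ↔ ∃ i j : Fin m, f a = some i ∧ g b = some j ∧ i ≤ j)) ∧
      (∃ Efin : Finset ((ℝ ⊕ Fin m ⊕ ℝ) × (ℝ ⊕ Fin m ⊕ ℝ)),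
        (∀ e, chainAdj A B f g e.1 e.2 ↔ e ∈ Efin) ∧ Efin.card ≤ 2 * n - 1) ∧
      (∀ a ∈ A, ∀ b ∈ B,
        (a < b ↔ ∃ l : List (ℝ ⊕ Fin m ⊕ ℝ),
          List.Chain' (chainAdj A B f g) (Sum.inl a :: (l ++ [Sum.inr (Sum.inr b)])))) ∧
      (∀ a ∈ A, ∀ b ∈ B, a < b →
        ∃! l : List (ℝ ⊕ Fin m ⊕ ℝ),
          List.Chain' (chainAdj A B f g) (Sum.inl a :: (l ++ [Sum.inr (Sum.inr b)]))) ∧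
      (∀ l : List (ℝ ⊕ Fin m ⊕ ℝ), List.Chain' (chainAdj A B f g) l → l.length ≤ m + 2) := by
  obtain ⟨f, g, hfg⟩ := SharedRanges.exists_indices A
  obtain ⟨E, hE, hcard⟩ := SharedRanges.exists_edgeFinset A B f g
  have path : ∀ a ∈ A, ∀ b ∈ B, (a < b ↔ ∃ l : List (ℝ ⊕ Fin A.card ⊕ ℝ),
      List.IsChain (chainAdj A B f g) (Sum.inl a :: (l ++ [Sum.inr (Sum.inr b)]))) :=
    fun a ha b hb => (hfg a ha b).trans (SharedRanges.exists_isChain_iff ha hb).symm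
  refine ⟨A.card, f, g, by omega, fun a ha b _ => hfg a ha b, ⟨E, hE, by omega⟩, path,
    fun a ha b hb hab => ?_, fun l hl => SharedRanges.length_le_of_isChain hl⟩
  obtain ⟨l, hl⟩ := (path a ha b hb).mp hab
  exact ⟨l, hl, fun l' hl' => SharedRanges.isChain_unique hl' hl⟩
end

section
/- For every p ≥ 1 there exists a constant C (depending only on p) such that for all finite sets A, B ⊆ ℝ^p with |A| + |B| = n ≥ 2, the relation R = {(a,b) ∈ A × B : a_j < b_j for all j ∈ {1,…,p}} admits a duplicate-free depth-3 factorization of size at most C · n · (1 + log₂ n)^{p−1} · (1 + log₂(1 + log₂ n)). -/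
/-- `R` has a duplicate-free depth-3 factorization on `A × B` with at most `s` edges, where the
intermediate layers may be arbitrary finite types. -/
def HasDupFreeFact {α β : Type*} (A : Finset α) (B : Finset β) (R : α → β → Prop) (s : ℕ) : Prop :=
  ∃ (X Y : Type) (_ : Finite X) (_ : Finite Y) (E1 : Finset (α × X)) (E2 : Finset (X × Y))
    (E3 : Finset (Y × β)),
    (∀ e ∈ E1, e.1 ∈ A) ∧ (∀ e ∈ E3, e.2 ∈ B) ∧
    (∀ a b x y, (a, x) ∈ E1 → (x, y) ∈ E2 → (y, b) ∈ E3 → R a b) ∧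
    (∀ a ∈ A, ∀ b ∈ B, R a b → ∃! w : X × Y, (a, w.1) ∈ E1 ∧ (w.1, w.2) ∈ E2 ∧ (w.2, b) ∈ E3) ∧
    E1.card + E2.card + E3.card ≤ s

namespace HasDupFreeFact

variable {α β : Type*} {A : Finset α} {B : Finset β} {R : α → β → Prop}

theorem mono {s t : ℕ} (h : HasDupFreeFact A B R s) (hst : s ≤ t) : HasDupFreeFact A B R t := by
  obtain ⟨X, Y, hX, hY, E1, E2, E3, h1, h2, h3, h4, h5⟩ := h
  exact ⟨X, Y, hX, hY, E1, E2, E3, h1, h2, h3, h4, h5.trans hst⟩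

theorem empty (hR : ∀ a ∈ A, ∀ b ∈ B, ¬ R a b) (s : ℕ) : HasDupFreeFact A B R s :=
  ⟨Empty, Empty, inferInstance, inferInstance, ∅, ∅, ∅, by simp, by simp, by simp,
    fun a ha b hb h => (hR a ha b hb h).elim, by simp⟩

theorem congr {R' : α → β → Prop} {s : ℕ} (h : HasDupFreeFact A B R s)
    (hR : ∀ a ∈ A, ∀ b ∈ B, (R a b ↔ R' a b)) : HasDupFreeFact A B R' s := by
  obtain ⟨X, Y, hX, hY, E1, E2, E3, h1, h2, h3, h4, h5⟩ := h
  exact ⟨X, Y, hX, hY, E1, E2, E3, h1, h2,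
    fun a b x y ha hxy hb => (hR a (h1 _ ha) b (h2 _ hb)).1 (h3 a b x y ha hxy hb),
    fun a ha b hb h => h4 a ha b hb ((hR a ha b hb).2 h), h5⟩

theorem of_filter {P : α → Prop} {Q : β → Prop} [DecidablePred P] [DecidablePred Q] {s : ℕ}
    (h : HasDupFreeFact (A.filter P) (B.filter Q) R s) :
    HasDupFreeFact A B (fun a b => P a ∧ Q b ∧ R a b) s := by
  obtain ⟨X, Y, hX, hY, E1, E2, E3, h1, h2, h3, h4, h5⟩ := h
  refine ⟨X, Y, hX, hY, E1, E2, E3, fun e he => (Finset.mem_filter.1 (h1 e he)).1,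
    fun e he => (Finset.mem_filter.1 (h2 e he)).1,
    fun a b x y ha hxy hb => ⟨(Finset.mem_filter.1 (h1 _ ha)).2, (Finset.mem_filter.1 (h2 _ hb)).2,
      h3 a b x y ha hxy hb⟩,
    fun a ha b hb h => h4 a (Finset.mem_filter.2 ⟨ha, h.1⟩) b (Finset.mem_filter.2 ⟨hb, h.2.1⟩) h.2.2,
    h5⟩

open Classical in
/-- A relation that factors through a relation on `Fin r` costs one edge per vertex and at most
`r * r` edges in the middle. -/
theorem of_classes {r : ℕ} (Q : ℕ → ℕ → Prop) (φ : α → ℕ) (ψ : β → ℕ)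
    (hφ : ∀ a ∈ A, φ a < r) (hψ : ∀ b ∈ B, ψ b < r) :
    HasDupFreeFact A B (fun a b => Q (φ a) (ψ b)) (A.card + r * r + B.card) := by
  refine ⟨Fin r, Fin r, inferInstance, inferInstance,
    (A ×ˢ Finset.univ).filter (fun e => φ e.1 = e.2), Finset.univ.filter (fun e => Q e.1 e.2),
    (Finset.univ ×ˢ B).filter (fun e => ψ e.2 = e.1), ?_, ?_, ?_, ?_, ?_⟩
  · simp +contextual
  · simp +contextual
  · simp +contextual
  · intro a ha b hb h
    refine ⟨(⟨φ a, hφ a ha⟩, ⟨ψ b, hψ b hb⟩), by simp [ha, hb, h], ?_⟩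
    rintro ⟨x, y⟩ hw
    simp only [Finset.mem_filter, Finset.mem_product, Finset.mem_univ] at hw
    ext
    · exact hw.1.2.symm
    · exact hw.2.2.2.symm
  · gcongr
    · refine Finset.card_le_card_of_injOn Prod.fst (fun e he => ?_) (fun e he e' he' h => ?_)
      · simp only [Finset.coe_filter, Finset.mem_product, Set.mem_ofPred_eq] at he
        exact he.1.1
      · simp only [Finset.coe_filter, Finset.mem_product, Set.mem_ofPred_eq] at he he'
        refine Prod.ext h (Fin.ext ?_)
        rw [← he.2, ← he'.2, h]
    · exact (Finset.card_filter_le _ _).trans (by simp)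
    · refine Finset.card_le_card_of_injOn Prod.snd (fun e he => ?_) (fun e he e' he' h => ?_)
      · simp only [Finset.coe_filter, Finset.mem_product, Set.mem_ofPred_eq] at he
        exact he.1.2
      · simp only [Finset.coe_filter, Finset.mem_product, Set.mem_ofPred_eq] at he he'
        refine Prod.ext (Fin.ext ?_) h
        rw [← he.2, ← he'.2, h]

open Classical in
/-- Factorizations of the parts of a partitioned relation combine by disjoint union of layers. -/
theorem iUnion {ι : Type} [Fintype ι] {A' : ι → Finset α} {B' : ι → Finset β}
    {R' : ι → α → β → Prop} {s : ι → ℕ} (h : ∀ i, HasDupFreeFact (A' i) (B' i) (R' i) (s i))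
    (hA : ∀ i, A' i ⊆ A) (hB : ∀ i, B' i ⊆ B)
    (hsound : ∀ i, ∀ a ∈ A' i, ∀ b ∈ B' i, R' i a b → R a b)
    (huniq : ∀ a ∈ A, ∀ b ∈ B, R a b → ∃! i, a ∈ A' i ∧ b ∈ B' i ∧ R' i a b) :
    HasDupFreeFact A B R (∑ i, s i) := by
  choose X Y hX hY E1 E2 E3 h1 h2 h3 h4 h5 using h
  refine ⟨Σ i, X i, Σ i, Y i, inferInstance, inferInstance,
    (Finset.univ.sigma E1).image (fun e => (e.2.1, ⟨e.1, e.2.2⟩)),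
    (Finset.univ.sigma E2).image (fun e => (⟨e.1, e.2.1⟩, ⟨e.1, e.2.2⟩)),
    (Finset.univ.sigma E3).image (fun e => (⟨e.1, e.2.1⟩, e.2.2)), ?_, ?_, ?_, ?_, ?_⟩
  · simp only [Finset.mem_image, Finset.mem_sigma, Finset.mem_univ, true_and]
    rintro _ ⟨⟨i, e⟩, he, rfl⟩
    exact hA i (h1 i e he)
  · simp only [Finset.mem_image, Finset.mem_sigma, Finset.mem_univ, true_and]
    rintro _ ⟨⟨i, e⟩, he, rfl⟩
    exact hB i (h2 i e he)
  · simp only [Finset.mem_image, Finset.mem_sigma, Finset.mem_univ, true_and]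
    rintro a b x y ⟨⟨i, a', x'⟩, he, hi⟩ ⟨⟨j, x'', y'⟩, he', hj⟩ ⟨⟨k, y'', b'⟩, he'', hk⟩
    simp only [Prod.mk.injEq] at hi hj hk
    obtain ⟨rfl, rfl⟩ := hi
    obtain ⟨hx, rfl⟩ := hj
    obtain ⟨hy, rfl⟩ := hk
    cases hx
    cases hy
    exact hsound i _ (h1 i _ he) _ (h2 i _ he'') (h3 i _ _ _ _ he he' he'')
  · intro a ha b hb hab
    obtain ⟨i, ⟨hai, hbi, hi⟩, hu⟩ := huniq a ha b hb hab
    obtain ⟨⟨x, y⟩, ⟨hax, hxy, hyb⟩, hw⟩ := h4 i a hai b hbi hi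
    refine ⟨(⟨i, x⟩, ⟨i, y⟩), ⟨?_, ?_, ?_⟩, ?_⟩
    · exact Finset.mem_image.2 ⟨⟨i, a, x⟩, by simpa using hax, rfl⟩
    · exact Finset.mem_image.2 ⟨⟨i, x, y⟩, by simpa using hxy, rfl⟩
    · exact Finset.mem_image.2 ⟨⟨i, y, b⟩, by simpa using hyb, rfl⟩
    · simp only [Finset.mem_image, Finset.mem_sigma, Finset.mem_univ, true_and]
      rintro ⟨x₁, y₁⟩ ⟨⟨⟨j, a', x'⟩, he, hj⟩, ⟨⟨j', x'', y'⟩, he', hj'⟩, ⟨⟨j'', y'', b'⟩, he'', hj''⟩⟩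
      simp only [Prod.mk.injEq] at hj hj' hj''
      obtain ⟨rfl, rfl⟩ := hj
      obtain ⟨hx, rfl⟩ := hj'
      obtain ⟨hy, rfl⟩ := hj''
      cases hx
      cases hy
      obtain rfl : j = i :=
        hu j ⟨h1 j _ he, h2 j _ he'', h3 j _ _ _ _ he he' he''⟩
      cases hw (x', y') ⟨he, he', he''⟩
      rfl
  · calc _ ≤ ∑ i, (E1 i).card + ∑ i, (E2 i).card + ∑ i, (E3 i).card := by
          gcongr <;> exact Finset.card_image_le.trans (Finset.card_sigma _ _).le
      _ = ∑ i, ((E1 i).card + (E2 i).card + (E3 i).card) := by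
          simp only [Finset.sum_add_distrib]
      _ ≤ _ := Finset.sum_le_sum fun i _ => h5 i

open Classical in
/-- Combine a factorization of the pairs in different blocks with linear-size factorizations
inside each of `r` blocks. -/
theorem of_blocks {R₀ R₁ : α → β → Prop} {s c r : ℕ} {φ : α → ℕ} {ψ : β → ℕ}
    (h₀ : HasDupFreeFact A B R₀ s)
    (h₁ : ∀ q < r, HasDupFreeFact (A.filter (φ · = q)) (B.filter (ψ · = q)) R₁
      (c * ((A.filter (φ · = q)).card + (B.filter (ψ · = q)).card)))
    (hφ : ∀ a ∈ A, φ a < r) (hψ : ∀ b ∈ B, ψ b < r)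
    (hR : ∀ a ∈ A, ∀ b ∈ B, (R a b ↔ R₀ a b ∨ φ a = ψ b ∧ R₁ a b))
    (hdisj : ∀ a ∈ A, ∀ b ∈ B, R₀ a b → φ a ≠ ψ b ∨ ¬ R₁ a b) :
    HasDupFreeFact A B R (s + c * (A.card + B.card)) := by
  have key := iUnion (A := A) (B := B) (R := R) (ι := Option (Fin r))
    (A' := fun o => o.elim A fun q => A.filter (φ · = q))
    (B' := fun o => o.elim B fun q => B.filter (ψ · = q))
    (R' := fun o => o.elim R₀ fun _ => R₁)
    (s := fun o => o.elim s fun q =>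
      c * ((A.filter (φ · = (q : ℕ))).card + (B.filter (ψ · = (q : ℕ))).card))
    (by rintro (_ | q)
        · exact h₀
        · exact h₁ q q.2)
    (by rintro (_ | q) <;> simp)
    (by rintro (_ | q) <;> simp)
    (by rintro (_ | q) a ha b hb hab
        · exact (hR a ha b hb).2 (Or.inl hab)
        · simp only [Option.elim, Finset.mem_filter] at ha hb hab
          exact (hR a ha.1 b hb.1).2 (Or.inr ⟨ha.2.trans hb.2.symm, hab⟩))
    (by intro a ha b hb hab
        by_cases h : R₀ a b
        · refine ⟨none, ⟨ha, hb, h⟩, ?_⟩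
          rintro (_ | q) hq
          · rfl
          · simp only [Option.elim, Finset.mem_filter] at hq
            have := hdisj a ha b hb h
            grind
        · obtain ⟨h1, h2⟩ := ((hR a ha b hb).1 hab).resolve_left h
          refine ⟨some ⟨φ a, hφ a ha⟩, by simp [ha, hb, h1, h2], ?_⟩
          rintro (_ | q) hq
          · exact (h hq.2.2).elim
          · simp only [Option.elim, Finset.mem_filter] at hq
            exact congrArg some (Fin.ext hq.1.2.symm))
  refine key.mono (le_of_eq ?_)
  rw [Fintype.sum_option]
  simp only [Option.elim]
  rw [← Finset.mul_sum, Finset.sum_add_distrib,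
    ← Finset.sum_range (fun q => (A.filter (φ · = q)).card),
    ← Finset.sum_range (fun q => (B.filter (ψ · = q)).card),
    ← Finset.card_eq_sum_card_fiberwise (fun a ha => by simpa using hφ a ha),
    ← Finset.card_eq_sum_card_fiberwise (fun b hb => by simpa using hψ b hb)]

end HasDupFreeFact

open Classical in
/-- The elements of a finite set can be numbered compatibly with a key in a linear order. -/
theorem Finset.exists_rank {γ K : Type*} [LinearOrder K] (T : Finset γ) (h : γ → K) :
    ∃ pos : γ → ℕ, (∀ x ∈ T, pos x < T.card) ∧ Set.InjOn pos T ∧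
      ∀ x ∈ T, ∀ y ∈ T, h x < h y → pos x < pos y := by
  induction T using Finset.induction_on_max_value h with
  | empty => exact ⟨fun _ => 0, by simp⟩
  | insert a s ha hmax ih =>
    obtain ⟨pos, hlt, hinj, hmono⟩ := ih
    have hne : ∀ x ∈ s, x ≠ a := fun x hx hxa => ha (hxa ▸ hx)
    refine ⟨fun x => if x = a then s.card else pos x, ?_, ?_, ?_⟩
    · intro x hx
      rw [Finset.card_insert_of_notMem ha]
      grind
    · intro x hx y hy hxy
      have := @hinj x
      grind
    · intro x hx y hy hxy
      have := hmax x
      have := hmax y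
      grind

open Classical in
/-- Two families of real keys can be replaced by distinct positions `0, …, |A| + |B| - 1` without
changing the strict comparisons from `A` to `B`. -/
theorem exists_positions {α β : Type*} (A : Finset α) (B : Finset β) (f : α → ℝ) (g : β → ℝ) :
    ∃ (φ : α → ℕ) (ψ : β → ℕ), (∀ a ∈ A, φ a < A.card + B.card) ∧
      (∀ b ∈ B, ψ b < A.card + B.card) ∧
      (∀ S : Finset ℕ, (A.filter (φ · ∈ S)).card + (B.filter (ψ · ∈ S)).card ≤ S.card) ∧
      ∀ a ∈ A, ∀ b ∈ B, (f a < g b ↔ φ a < ψ b) := by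
  obtain ⟨pos, hlt, hinj, hmono⟩ := (A.disjSum B).exists_rank (K := ℝ ×ₗ ℕ)
    (Sum.elim (fun a => toLex (f a, 1)) (fun b => toLex (g b, 0)))
  rw [Finset.card_disjSum] at hlt
  refine ⟨fun a => pos (Sum.inl a), fun b => pos (Sum.inr b), fun a ha => hlt _ (by simpa),
    fun b hb => hlt _ (by simpa), fun S => ?_, fun a ha b hb => ⟨fun h => ?_, fun h => ?_⟩⟩
  · rw [← Finset.card_disjSum]
    refine Finset.card_le_card_of_injOn pos ?_ (hinj.mono ?_)
    · rintro (a | b) h <;> simp_all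
    · rintro (a | b) h <;> simp_all
  · refine hmono _ (by simpa) _ (by simpa) ?_
    simp [Prod.Lex.toLex_lt_toLex, h]
  · by_contra! hle
    refine h.not_gt (hmono _ (by simpa) _ (by simpa) ?_)
    simpa [Prod.Lex.toLex_lt_toLex, le_iff_lt_or_eq] using hle

namespace HasDupFreeFact

variable {α β : Type*}

open Classical in
/-- Multiway partitioning: a single inequality. -/
theorem lt_of_card_le (f : α → ℝ) (g : β → ℝ) (k : ℕ) (A : Finset α) (B : Finset β)
    (hk : A.card + B.card ≤ 2 ^ 2 ^ k) :
    HasDupFreeFact A B (fun a b => f a < g b) (3 * (k + 1) * (A.card + B.card)) := by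
  induction k generalizing A B with
  | zero =>
    obtain ⟨φ, ψ, hφ, hψ, -, hlt⟩ := exists_positions A B f g
    refine ((of_classes (· < ·) φ ψ hφ hψ).congr fun a ha b hb => (hlt a ha b hb).symm).mono ?_
    norm_num at hk ⊢
    nlinarith
  | succ k ih =>
    obtain ⟨φ, ψ, hφ, hψ, hcard, hlt⟩ := exists_positions A B f g
    obtain hm | hm := Nat.eq_zero_or_pos (A.card + B.card)
    · refine empty (fun a ha => ?_) _
      have : A = ∅ := by simpa using (Nat.add_eq_zero_iff.1 hm).1
      simp [this] at ha
    generalize hmdef : A.card + B.card = m at *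
    obtain ⟨s, hs0, hms, hsm, hsk⟩ : ∃ s, 0 < s ∧ m ≤ s * s ∧ s * s ≤ 2 * m ∧ s ≤ 2 ^ 2 ^ k := by
      refine ⟨Nat.sqrt (m - 1) + 1, by omega, ?_, ?_, ?_⟩
      · have := Nat.lt_succ_sqrt (m - 1)
        simp only [Nat.succ_eq_add_one] at this
        omega
      · have h := Nat.sqrt_le (m - 1)
        zify [hm] at h ⊢
        nlinarith [sq_nonneg (((m - 1).sqrt : ℤ) - 1)]
      · rw [Nat.succ_le_iff, Nat.sqrt_lt, ← pow_two, ← pow_mul, ← pow_succ]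
        omega
    have hdiv : ∀ u < m, u / s < s := fun u hu => Nat.div_lt_of_lt_mul (by omega)
    have hblock : ∀ q, (A.filter (φ · / s = q)).card + (B.filter (ψ · / s = q)).card ≤ s := by
      intro q
      have h := hcard (Finset.Ico (q * s) (q * s + s))
      simp only [Nat.card_Ico, Nat.add_sub_cancel_left] at h
      refine le_trans (le_of_eq ?_) h
      congr 2 <;> refine Finset.filter_congr fun x _ => ?_ <;>
        rw [Nat.div_eq_iff hs0, Finset.mem_Ico] <;> omega
    have key := of_blocks (R := fun a b => f a < g b) (r := s) (c := 3 * (k + 1))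
      (of_classes (A := A) (B := B) (· < ·) (fun a => φ a / s) (fun b => ψ b / s)
        (fun a ha => hdiv _ (hφ a ha)) (fun b hb => hdiv _ (hψ b hb)))
      (fun q _ => ih _ _ ((hblock q).trans hsk))
      (fun a ha => hdiv _ (hφ a ha)) (fun b hb => hdiv _ (hψ b hb))
      (fun a ha b hb => by
        rw [hlt a ha b hb]
        constructor
        · intro h
          have := Nat.div_le_div_right (c := s) h.le
          omega
        · rintro (h | h)
          · by_contra! h'
            have := Nat.div_le_div_right (c := s) h'
            omega
          · exact h.2)
      (fun a _ b _ h => Or.inl (ne_of_lt h))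
    refine key.mono ?_
    rw [hmdef]
    nlinarith

open Classical in
/-- Binary partitioning by positions: each of the `k` levels adds `c` edges per vertex. -/
theorem and_pos_lt {A₀ : Finset α} {B₀ : Finset β} {R : α → β → Prop} {c : ℕ}
    (h : ∀ A ⊆ A₀, ∀ B ⊆ B₀, HasDupFreeFact A B R (c * (A.card + B.card))) (k : ℕ)
    (φ : α → ℕ) (ψ : β → ℕ) (hφ : ∀ a ∈ A₀, φ a < 2 ^ k) (hψ : ∀ b ∈ B₀, ψ b < 2 ^ k)
    (A : Finset α) (hA : A ⊆ A₀) (B : Finset β) (hB : B ⊆ B₀) :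
    HasDupFreeFact A B (fun a b => φ a < ψ b ∧ R a b) (c * k * (A.card + B.card)) := by
  induction k generalizing φ ψ with
  | zero =>
    refine empty (fun a ha b hb h => ?_) _
    have := hψ b (hB hb)
    omega
  | succ k ih =>
    have hφ' : ∀ a ∈ A₀, φ a / 2 < 2 ^ k := fun a ha => by have := hφ a ha; omega
    have hψ' : ∀ b ∈ B₀, ψ b / 2 < 2 ^ k := fun b hb => by have := hψ b hb; omega
    have key := of_blocks (R := fun a b => φ a < ψ b ∧ R a b)
      (R₁ := fun a b => φ a % 2 = 0 ∧ ψ b % 2 = 1 ∧ R a b) (c := c)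
      (ih (fun a => φ a / 2) (fun b => ψ b / 2) hφ' hψ')
      (fun q _ => of_filter ((h _ (fun a ha => hA (Finset.mem_filter.1 (Finset.mem_filter.1 ha).1).1)
        _ (fun b hb => hB (Finset.mem_filter.1 (Finset.mem_filter.1 hb).1).1)).mono
        (by gcongr <;> exact Finset.filter_subset _ _)))
      (fun a ha => hφ' a (hA ha)) (fun b hb => hψ' b (hB hb))
      (fun a _ b _ => by
        by_cases hR : R a b
        · simp only [hR, and_true]
          omega
        · simp [hR])
      (fun a _ b _ h => Or.inl (ne_of_lt h.1))
    exact key.mono (le_of_eq (by ring))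

/-- Adding one inequality to a relation whose restrictions have linear-size factorizations. -/
theorem and_lt {A₀ : Finset α} {B₀ : Finset β} {R : α → β → Prop} {c k : ℕ}
    (hk : A₀.card + B₀.card ≤ 2 ^ k)
    (h : ∀ A ⊆ A₀, ∀ B ⊆ B₀, HasDupFreeFact A B R (c * (A.card + B.card)))
    (f : α → ℝ) (g : β → ℝ) (A : Finset α) (hA : A ⊆ A₀) (B : Finset β) (hB : B ⊆ B₀) :
    HasDupFreeFact A B (fun a b => f a < g b ∧ R a b) (c * k * (A.card + B.card)) := by
  obtain ⟨φ, ψ, hφ, hψ, -, hlt⟩ := exists_positions A₀ B₀ f g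
  refine (and_pos_lt h k φ ψ (fun a ha => (hφ a ha).trans_le hk)
    (fun b hb => (hψ b hb).trans_le hk) A hA B hB).congr fun a ha b hb => ?_
  rw [hlt a (hA ha) b (hB hb)]

theorem forall_lt {A₀ : Finset α} {B₀ : Finset β} {k l : ℕ} (hk : A₀.card + B₀.card ≤ 2 ^ k)
    (hl : k ≤ 2 ^ l) (p : ℕ) (f : Fin (p + 1) → α → ℝ) (g : Fin (p + 1) → β → ℝ)
    (A : Finset α) (hA : A ⊆ A₀) (B : Finset β) (hB : B ⊆ B₀) :
    HasDupFreeFact A B (fun a b => ∀ j, f j a < g j b)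
      (3 * (l + 1) * k ^ p * (A.card + B.card)) := by
  induction p generalizing A B with
  | zero =>
    have hcard : A.card + B.card ≤ 2 ^ 2 ^ l :=
      (add_le_add (Finset.card_le_card hA) (Finset.card_le_card hB)).trans
        (hk.trans (Nat.pow_le_pow_right two_pos hl))
    simpa using lt_of_card_le (f 0) (g 0) l A B hcard
  | succ p ih =>
    have := and_lt hk (fun A hA B hB => ih (fun j => f j.succ) (fun j => g j.succ) A hA B hB)
      (f 0) (g 0) A hA B hB
    simp only [Fin.forall_fin_succ (n := p + 1)]
    exact this.mono (le_of_eq (by ring))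

open Classical in
/-- Relabel the intermediate layers by `Fin x` and `Fin y`. -/
theorem exists_fin {A : Finset α} {B : Finset β} {R : α → β → Prop} {s : ℕ}
    (h : HasDupFreeFact A B R s) :
    ∃ (x y : ℕ) (E1 : Finset (α × Fin x)) (E2 : Finset (Fin x × Fin y)) (E3 : Finset (Fin y × β)),
      IsDepth3Fact A B R E1 E2 E3 ∧ IsDupFree A B R E1 E2 E3 ∧
        E1.card + E2.card + E3.card ≤ s := by
  obtain ⟨X, Y, hX, hY, E1, E2, E3, h1, h2, h3, h4, h5⟩ := h
  obtain ⟨x, ⟨eX⟩⟩ := Finite.exists_equiv_fin X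
  obtain ⟨y, ⟨eY⟩⟩ := Finite.exists_equiv_fin Y
  let F1 := E1.map ((Equiv.refl α).prodCongr eX).toEmbedding
  let F2 := E2.map (eX.prodCongr eY).toEmbedding
  let F3 := E3.map (eY.prodCongr (Equiv.refl β)).toEmbedding
  have m1 : ∀ a i, (a, i) ∈ F1 ↔ (a, eX.symm i) ∈ E1 := fun a i => by
    simp [F1, Finset.mem_map_equiv]
  have m2 : ∀ i j, (i, j) ∈ F2 ↔ (eX.symm i, eY.symm j) ∈ E2 := fun i j => by
    simp [F2, Finset.mem_map_equiv]
  have m3 : ∀ j b, (j, b) ∈ F3 ↔ (eY.symm j, b) ∈ E3 := fun j b => by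
    simp [F3, Finset.mem_map_equiv]
  have hdup : IsDupFree A B R F1 F2 F3 := by
    intro a ha b hb hab
    obtain ⟨w, hw, hu⟩ := h4 a ha b hb hab
    refine ⟨(eX w.1, eY w.2), by simpa [m1, m2, m3] using hw, ?_⟩
    rintro ⟨i, j⟩ hij
    simp only [m1, m2, m3] at hij
    rw [← hu (eX.symm i, eY.symm j) hij]
    simp
  refine ⟨x, y, F1, F2, F3, ⟨?_, ?_, fun a ha b hb => ⟨fun hab => ?_, ?_⟩⟩, hdup, ?_⟩
  · rintro ⟨a, i⟩ he
    exact h1 _ ((m1 a i).1 he)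
  · rintro ⟨j, b⟩ he
    exact h2 _ ((m3 j b).1 he)
  · obtain ⟨w, hw, -⟩ := hdup a ha b hb hab
    exact ⟨w.1, w.2, hw⟩
  · rintro ⟨i, j, hi, hij, hj⟩
    exact h3 a b _ _ ((m1 _ _).1 hi) ((m2 _ _).1 hij) ((m3 _ _).1 hj)
  · simpa [F1, F2, F3] using h5

end HasDupFreeFact

/-- Improved conjunction construction: for `p ≥ 1` there is a constant `C` (depending only on
`p`) such that for all `A, B ⊆ ℝ^p` with `|A| + |B| = n ≥ 2`, the relation requiring
`a_j < b_j` in every coordinate admits a duplicate-free depth-3 factorization of size at most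
`C · n · (1 + log₂ n)^(p-1) · (1 + log₂(1 + log₂ n))`. -/
theorem conjunction_depth3_factorization :
    ∀ p : ℕ, 1 ≤ p → ∃ C : ℝ,
      ∀ (A B : Finset (Fin p → ℝ)) (n : ℕ), A.card + B.card = n → 2 ≤ n →
        ∃ (x y : ℕ) (E1 : Finset ((Fin p → ℝ) × Fin x)) (E2 : Finset (Fin x × Fin y))
          (E3 : Finset (Fin y × (Fin p → ℝ))),
          IsDepth3Fact A B (fun a b => ∀ j : Fin p, a j < b j) E1 E2 E3 ∧
          IsDupFree A B (fun a b => ∀ j : Fin p, a j < b j) E1 E2 E3 ∧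
          ((E1.card : ℝ) + (E2.card : ℝ) + (E3.card : ℝ)) ≤
            C * n * (1 + Real.logb 2 n) ^ (p - 1) *
              (1 + Real.logb 2 (1 + Real.logb 2 n)) := by
  rintro (_ | p) hp
  · omega
  refine ⟨6, fun A B n hn h2 => ?_⟩
  have hk : n < 2 ^ (Nat.log 2 n + 1) := Nat.lt_pow_succ_log_self one_lt_two n
  have hl := Nat.lt_pow_succ_log_self one_lt_two (Nat.log 2 n + 1)
  have hkR : ((Nat.log 2 n + 1 : ℕ) : ℝ) ≤ 1 + Real.logb 2 n := by
    have := Real.natLog_le_logb n 2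
    push_cast at this ⊢
    linarith
  generalize Nat.log 2 n + 1 = k at hk hl hkR
  have hk0 : 0 < k := by
    by_contra! h0
    obtain rfl : k = 0 := by omega
    omega
  have hlR : (Nat.log 2 k : ℝ) ≤ Real.logb 2 (1 + Real.logb 2 n) := by
    refine (Real.natLog_le_logb k 2).trans ?_
    exact Real.logb_le_logb_of_le (by norm_num) (by exact_mod_cast hk0) hkR
  generalize Real.logb 2 (1 + Real.logb 2 n) = L at hlR
  obtain ⟨x, y, E1, E2, E3, hfact, hdup, hsize⟩ :=
    (HasDupFreeFact.forall_lt (hn.trans_le hk.le) hl.le p (fun j a => a j) (fun j b => b j)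
      A subset_rfl B subset_rfl).exists_fin
  refine ⟨x, y, E1, E2, E3, hfact, hdup, ?_⟩
  rw [hn] at hsize
  calc _ ≤ (3 * ((Nat.log 2 k + 1 : ℕ) + 1) * k ^ p * n : ℝ) := by exact_mod_cast hsize
    _ ≤ 3 * (2 * (1 + L)) * (1 + Real.logb 2 n) ^ p * n := by
      have : (0 : ℝ) ≤ Nat.log 2 k := Nat.cast_nonneg _
      have hle : ((Nat.log 2 k + 1 : ℕ) + 1 : ℝ) ≤ 2 * (1 + L) := by
        push_cast
        linarith
      have : 0 ≤ 1 + L := by linarith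
      gcongr
    _ = _ := by
      rw [Nat.add_sub_cancel]
      ring
end

section
/- Fix m ∈ ℕ and let θ be a DNF formula with r disjuncts, where each atomic predicate compares a coordinate a_j of the left tuple with a coordinate b_{j'} of the right tuple via one of: an inequality (a_j < b_{j'}, a_j ≤ b_{j'}, a_j > b_{j'}, or a_j ≥ b_{j'}), a non-equality (a_j ≠ b_{j'}), a band (|a_j − b_{j'}| < ε for a fixed ε > 0), or an equality (a_j = b_{j'}), and where each disjunct contains at most p ≥ 1 atoms that are not equalities. Then there exists a constant C (depending only on θ) such that for all finite sets A, B ⊆ ℝ^m with |A| + |B| = n ≥ 2, the relation R_θ = {(a,b) ∈ A × B : θ(a,b) holds} admits a depth-3 factorization of size at most C · n · (1 + log₂ n)^{p−1} · (1 + log₂(1 + log₂ n)) in which every pair (a,b) ∈ R_θ has at least one and at most r witnessing pairs (x,y). -/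
/-- The number of witnessing pairs of intermediate nodes connecting `a` to `b`. -/
noncomputable def witnessCount {α β : Type*} {x y : ℕ} (E1 : Finset (α × Fin x))
    (E2 : Finset (Fin x × Fin y)) (E3 : Finset (Fin y × β)) (a : α) (b : β) : ℕ :=
  Nat.card {w : Fin x × Fin y // (a, w.1) ∈ E1 ∧ (w.1, w.2) ∈ E2 ∧ (w.2, b) ∈ E3}

/-- An atomic join predicate comparing coordinate `j` of the left tuple with coordinate `j'`
of the right tuple: an inequality, a non-equality, a band (with its width `ε`), or an
equality. -/
inductive JoinAtom (m : ℕ) where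
  | lt (j j' : Fin m)
  | le (j j' : Fin m)
  | gt (j j' : Fin m)
  | ge (j j' : Fin m)
  | ne (j j' : Fin m)
  | band (j j' : Fin m) (ε : ℝ)
  | eq (j j' : Fin m)

/-- The truth value of an atomic join predicate on a pair of tuples. -/
def JoinAtom.eval {m : ℕ} : JoinAtom m → (Fin m → ℝ) → (Fin m → ℝ) → Prop
  | .lt j j', a, b => a j < b j'
  | .le j j', a, b => a j ≤ b j'
  | .gt j j', a, b => a j > b j'
  | .ge j j', a, b => a j ≥ b j'
  | .ne j j', a, b => a j ≠ b j'
  | .band j j' ε, a, b => |a j - b j'| < ε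
  | .eq j j', a, b => a j = b j'

/-- Whether an atomic join predicate is an equality. -/
def JoinAtom.isEq {m : ℕ} : JoinAtom m → Bool
  | .eq _ _ => true
  | _ => false

open Classical in
/-- The number of paths `a → x → y → b` through a layered graph with three edge sets. -/
noncomputable def pathCount {α β X Y : Type*} [Fintype X] [Fintype Y] (E1 : Finset (α × X))
    (E2 : Finset (X × Y)) (E3 : Finset (Y × β)) (a : α) (b : β) : ℕ :=
  ∑ x, ∑ y, if (a, x) ∈ E1 ∧ (x, y) ∈ E2 ∧ (y, b) ∈ E3 then 1 else 0

/-- The multiplicity function `μ` is realized as the path count of a depth-3 layered graph with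
at most `s` edges. -/
def HasFactorization {α β : Type*} (μ : α → β → ℕ) (s : ℕ) : Prop :=
  ∃ (X Y : Type) (_ : Fintype X) (_ : Fintype Y) (E1 : Finset (α × X)) (E2 : Finset (X × Y))
    (E3 : Finset (Y × β)), E1.card + E2.card + E3.card ≤ s ∧ ∀ a b, pathCount E1 E2 E3 a b = μ a b

open Classical in
/-- The indicator of the relation `Q` restricted to `A × B`. -/
noncomputable def relIndicator {α β : Type*} (A : Finset α) (B : Finset β) (Q : α → β → Prop)
    (a : α) (b : β) : ℕ :=
  if a ∈ A ∧ b ∈ B ∧ Q a b then 1 else 0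

/-- On all pairs of finite sets of total size at most `N`, the relation `Q` has a duplicate-free
factorization with at most `c` edges per element. -/
def HasLinearFactorization {α β : Type*} (N : ℕ) (Q : α → β → Prop) (c : ℕ) : Prop :=
  ∀ (A : Finset α) (B : Finset β), A.card + B.card ≤ N →
    HasFactorization (relIndicator A B Q) (c * (A.card + B.card))

/-- On every finite set `A`, the relation `R` is a comparison `f a < g b` of natural numbers
at most `A.card`. -/
def IsRankable {α β : Type*} (R : α → β → Prop) : Prop :=
  ∀ A : Finset α, ∃ (f : α → ℕ) (g : β → ℕ), (∀ a ∈ A, ∀ b, R a b ↔ f a < g b) ∧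
    (∀ a, f a ≤ A.card) ∧ ∀ b, g b ≤ A.card

theorem card_image_union_image_le {γ δ ε : Type*} [DecidableEq ε] (E : Finset γ) (F : Finset δ)
    (i : γ → ε) (j : δ → ε) : (E.image i ∪ F.image j).card ≤ E.card + F.card :=
  (Finset.card_union_le _ _).trans (add_le_add Finset.card_image_le Finset.card_image_le)

section Factorization

variable {α β : Type*}

namespace HasFactorization

theorem mono {μ : α → β → ℕ} {s t : ℕ} (h : HasFactorization μ s) (hst : s ≤ t) :
    HasFactorization μ t := by
  obtain ⟨X, Y, _, _, E1, E2, E3, hs, hμ⟩ := h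
  exact ⟨X, Y, _, _, E1, E2, E3, hs.trans hst, hμ⟩

theorem zero (s : ℕ) : HasFactorization (0 : α → β → ℕ) s :=
  ⟨Empty, Empty, inferInstance, inferInstance, ∅, ∅, ∅, by simp, by simp [pathCount]⟩

theorem add {μ ν : α → β → ℕ} {s t : ℕ} (hμ : HasFactorization μ s) (hν : HasFactorization ν t) :
    HasFactorization (μ + ν) (s + t) := by
  classical
  obtain ⟨X, Y, _, _, E1, E2, E3, hs, hμ⟩ := hμ
  obtain ⟨X', Y', _, _, F1, F2, F3, ht, hν⟩ := hν
  refine ⟨X ⊕ X', Y ⊕ Y', inferInstance, inferInstance,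
    E1.image (Prod.map id Sum.inl) ∪ F1.image (Prod.map id Sum.inr),
    E2.image (Prod.map Sum.inl Sum.inl) ∪ F2.image (Prod.map Sum.inr Sum.inr),
    E3.image (Prod.map Sum.inl id) ∪ F3.image (Prod.map Sum.inr id), ?_, fun a b => ?_⟩
  · have h1 := card_image_union_image_le E1 F1 (Prod.map id Sum.inl) (Prod.map id Sum.inr)
    have h2 := card_image_union_image_le E2 F2 (Prod.map (Sum.inl : X → X ⊕ X') Sum.inl)
      (Prod.map Sum.inr (Sum.inr : Y' → Y ⊕ Y'))
    have h3 := card_image_union_image_le E3 F3 (Prod.map Sum.inl id) (Prod.map Sum.inr id)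
    omega
  · rw [Pi.add_apply, Pi.add_apply, ← hμ, ← hν]
    simp [pathCount, Fintype.sum_sum_type]

theorem sum {ι : Type*} (S : Finset ι) {μ : ι → α → β → ℕ} {s : ι → ℕ}
    (h : ∀ i ∈ S, HasFactorization (μ i) (s i)) :
    HasFactorization (∑ i ∈ S, μ i) (∑ i ∈ S, s i) := by
  classical
  induction S using Finset.induction_on with
  | empty => exact zero _
  | insert i S hi ih =>
    rw [Finset.sum_insert hi, Finset.sum_insert hi]
    exact (h i (by simp)).add (ih fun j hj => h j (by simp [hj]))

/-- Routing elements through buckets `X` realizes any relation that depends on buckets only. -/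
theorem of_buckets {X : Type} [Fintype X] (A : Finset α) (B : Finset β) (u : α → X) (v : β → X)
    (P : X → X → Prop) :
    HasFactorization (relIndicator A B fun a b => P (u a) (v b))
      (A.card + Fintype.card X ^ 2 + B.card) := by
  classical
  refine ⟨X, X, inferInstance, inferInstance, A.image fun a => (a, u a),
    Finset.univ.filter fun w => P w.1 w.2, B.image fun b => (v b, b), ?_, fun a b => ?_⟩
  · gcongr
    · exact Finset.card_image_le
    · exact (Finset.card_le_univ _).trans_eq (by simp [sq])
    · exact Finset.card_image_le
  · have key : ∀ x y, ((a, x) ∈ A.image (fun a => (a, u a)) ∧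
        (x, y) ∈ Finset.univ.filter (fun w : X × X => P w.1 w.2) ∧
        (y, b) ∈ B.image (fun b => (v b, b))) ↔
        x = u a ∧ y = v b ∧ (a ∈ A ∧ b ∈ B ∧ P (u a) (v b)) := by
      intro x y
      simp only [Finset.mem_image, Finset.mem_filter, Finset.mem_univ, true_and, Prod.mk.injEq]
      constructor
      · rintro ⟨⟨a, ha, rfl, rfl⟩, hP, b, hb, rfl, rfl⟩
        exact ⟨rfl, rfl, ha, hb, hP⟩
      · rintro ⟨rfl, rfl, ha, hb, hP⟩
        exact ⟨⟨a, ha, rfl, rfl⟩, hP, b, hb, rfl, rfl⟩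
    simp only [pathCount, key, relIndicator]
    simp [ite_and]

/-- An equality conjunct is handled by factorizing every equality class separately. -/
theorem and_eq_of_classes {γ : Type*} [DecidableEq γ] {A : Finset α} {B : Finset β}
    {Q : α → β → Prop} {u : α → γ} {v : β → γ} {S : Finset γ} (hS : ∀ a ∈ A, u a ∈ S)
    {s : γ → ℕ} (h : ∀ i ∈ S, HasFactorization
      (relIndicator (A.filter (u · = i)) (B.filter (v · = i)) Q) (s i)) :
    HasFactorization (relIndicator A B fun a b => Q a b ∧ u a = v b) (∑ i ∈ S, s i) := by
  classical
  convert sum S h using 1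
  ext a b
  rw [Finset.sum_apply, Finset.sum_apply]
  by_cases ha : a ∈ A
  · rw [Finset.sum_eq_single_of_mem (u a) (hS a ha)]
    · simp only [relIndicator, Finset.mem_filter, eq_comm (a := v b)]
      congr 1
      simp only [eq_iff_iff]
      tauto
    · intro i _ hi
      simp [relIndicator, Ne.symm hi]
  · simp [relIndicator, ha]

theorem or_of_disjoint {A : Finset α} {B : Finset β} {P Q R : α → β → Prop} {s t : ℕ}
    (hP : HasFactorization (relIndicator A B P) s) (hQ : HasFactorization (relIndicator A B Q) t)
    (hdisj : ∀ a ∈ A, ∀ b ∈ B, ¬ (P a b ∧ Q a b))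
    (hR : ∀ a ∈ A, ∀ b ∈ B, (R a b ↔ P a b ∨ Q a b)) :
    HasFactorization (relIndicator A B R) (s + t) := by
  classical
  convert hP.add hQ using 1
  ext a b
  by_cases ha : a ∈ A <;> by_cases hb : b ∈ B <;> simp [relIndicator, ha, hb]
  have := hdisj a ha b hb
  rw [hR a ha b hb]
  by_cases h1 : P a b <;> by_cases h2 : Q a b <;> simp_all

theorem congr {A : Finset α} {B : Finset β} {Q R : α → β → Prop} {s : ℕ}
    (h : HasFactorization (relIndicator A B Q) s) (hQR : ∀ a ∈ A, ∀ b ∈ B, (R a b ↔ Q a b)) :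
    HasFactorization (relIndicator A B R) s := by
  classical
  convert h using 1
  ext a b
  by_cases ha : a ∈ A <;> by_cases hb : b ∈ B <;> simp [relIndicator, ha, hb]
  rw [hQR a ha b hb]

theorem of_forall_not {A : Finset α} {B : Finset β} {Q : α → β → Prop} (s : ℕ)
    (h : ∀ a ∈ A, ∀ b ∈ B, ¬ Q a b) : HasFactorization (relIndicator A B Q) s := by
  convert zero s
  ext a b
  by_cases ha : a ∈ A <;> by_cases hb : b ∈ B <;> simp_all [relIndicator]

/-- Comparison of keys below `2 ^ e` with `e ≤ 2 ^ k`: pairs in different blocks of size about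
`√(2 ^ e)` go through the graph of blocks, pairs within a block are treated recursively. -/
theorem lt_of_lt_two_pow (k : ℕ) : ∀ e ≤ 2 ^ k, ∀ (A : Finset α) (B : Finset β) (f : α → ℕ)
    (g : β → ℕ), (∀ a ∈ A, f a < 2 ^ e) → (∀ b ∈ B, g b < 2 ^ e) →
    HasFactorization (relIndicator A B fun a b => f a < g b)
      ((k + 2) * (A.card + B.card + 2 ^ e)) := by
  have block {d : ℕ} {A : Finset α} {B : Finset β} {f : α → ℕ} {g : β → ℕ}
      (hf : ∀ a ∈ A, f a < 2 ^ d) (hg : ∀ b ∈ B, g b < 2 ^ d) :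
      HasFactorization (relIndicator A B fun a b => f a < g b)
        (A.card + 2 ^ (2 * d) + B.card) := by
    have h := of_buckets A B (fun a => Fin.ofNat (2 ^ d) (f a)) (fun b => Fin.ofNat (2 ^ d) (g b))
      (· < ·)
    rw [Fintype.card_fin, ← pow_mul, mul_comm d] at h
    refine h.congr fun a ha b hb => ?_
    simp [Fin.lt_def, Nat.mod_eq_of_lt (hf a ha), Nat.mod_eq_of_lt (hg b hb)]
  induction k with
  | zero =>
    intro e he A B f g hf hg
    refine (block hf hg).mono ?_
    have : 2 ^ (2 * e) ≤ 2 * 2 ^ e := by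
      rw [← pow_succ']
      exact Nat.pow_le_pow_right (by norm_num) (by simp at he; omega)
    omega
  | succ k ih =>
    intro e he A B f g hf hg
    set d := e / 2
    set d' := e - d
    have hdd : 2 ^ d * 2 ^ d' = 2 ^ e := by rw [← pow_add]; congr 1; omega
    have hdiv {n : ℕ} (hn : n < 2 ^ e) : n / 2 ^ d' < 2 ^ d :=
      Nat.div_lt_of_lt_mul (by rwa [mul_comm, hdd])
    have hcross := block (d := d) (f := fun a => f a / 2 ^ d') (g := fun b => g b / 2 ^ d')
      (fun a ha => hdiv (hf a ha)) (fun b hb => hdiv (hg b hb))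
    have hwithin := and_eq_of_classes (B := B) (S := Finset.range (2 ^ d))
      (u := fun a => f a / 2 ^ d') (v := fun b => g b / 2 ^ d')
      (fun a ha => Finset.mem_range.2 (hdiv (hf a ha)))
      fun i _ => ih d' (by rw [pow_succ] at he; omega) (A.filter (f · / 2 ^ d' = i))
        (B.filter (g · / 2 ^ d' = i)) (f · % 2 ^ d') (g · % 2 ^ d')
        (fun _ _ => Nat.mod_lt _ (by positivity)) (fun _ _ => Nat.mod_lt _ (by positivity))
    refine (hcross.or_of_disjoint hwithin (fun a _ b _ h => h.1.ne h.2.2)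
      fun a _ b _ => ?_).mono ?_
    · have ha := Nat.div_add_mod (f a) (2 ^ d')
      have hb := Nat.div_add_mod (g b) (2 ^ d')
      constructor
      · intro h
        rcases (Nat.div_le_div_right (c := 2 ^ d') h.le).lt_or_eq with h' | h'
        · exact Or.inl h'
        · rw [h'] at ha
          exact Or.inr ⟨by omega, h'⟩
      · rintro (h | ⟨h, h'⟩)
        · exact lt_of_not_ge fun hle => absurd (Nat.div_le_div_right (c := 2 ^ d') hle) (by omega)
        · rw [h'] at ha
          omega
    · rw [← Finset.mul_sum, Finset.sum_add_distrib, Finset.sum_add_distrib, Finset.sum_const,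
        Finset.card_range, smul_eq_mul, hdd]
      have hA : A.card = ∑ i ∈ Finset.range (2 ^ d), (A.filter (f · / 2 ^ d' = i)).card :=
        Finset.card_eq_sum_card_fiberwise fun a ha => by simpa using hdiv (hf a ha)
      have hB : B.card = ∑ i ∈ Finset.range (2 ^ d), (B.filter (g · / 2 ^ d' = i)).card :=
        Finset.card_eq_sum_card_fiberwise fun b hb => by simpa using hdiv (hg b hb)
      rw [← hA, ← hB]
      have : 2 ^ (2 * d) ≤ 2 ^ e := Nat.pow_le_pow_right (by norm_num) (by omega)
      nlinarith

end HasFactorization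

/-- Two reals are at distance less than one iff they lie in the same unit cell, or in adjacent
unit cells and satisfy the one remaining inequality. -/
theorem abs_sub_lt_one_iff_floor (x y : ℝ) : |x - y| < 1 ↔
    ⌊x⌋ = ⌊y⌋ ∨ (-x < 1 - y ∧ ⌊x⌋ + 1 = ⌊y⌋) ∨ (x < y + 1 ∧ ⌊x⌋ = ⌊y⌋ + 1) := by
  have hx := Int.floor_le x
  have hx' := Int.lt_floor_add_one x
  have hy := Int.floor_le y
  have hy' := Int.lt_floor_add_one y
  rw [abs_lt]
  constructor
  · rintro ⟨h1, h2⟩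
    have h3 : ⌊x⌋ < ⌊y⌋ + 2 := by
      have : (⌊x⌋ : ℝ) < ⌊y⌋ + 2 := by linarith
      exact_mod_cast this
    have h4 : ⌊y⌋ < ⌊x⌋ + 2 := by
      have : (⌊y⌋ : ℝ) < ⌊x⌋ + 2 := by linarith
      exact_mod_cast this
    rcases (by omega : ⌊x⌋ = ⌊y⌋ ∨ ⌊x⌋ + 1 = ⌊y⌋ ∨ ⌊x⌋ = ⌊y⌋ + 1) with h | h | h
    · exact Or.inl h
    · exact Or.inr (Or.inl ⟨by linarith, h⟩)
    · exact Or.inr (Or.inr ⟨by linarith, h⟩)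
  · rintro (h | ⟨h', h⟩ | ⟨h', h⟩)
    all_goals
      have h := congrArg (Int.cast : ℤ → ℝ) h
      push_cast at h
      constructor <;> linarith

namespace IsRankable

variable {L : Type*} [LinearOrder L]

theorem lt (f : α → L) (g : β → L) : IsRankable fun a b => f a < g b := by
  intro A
  refine ⟨fun a => (A.filter (f · < f a)).card, fun b => (A.filter (f · < g b)).card,
    fun a ha b => ⟨fun h => ?_, fun h => ?_⟩, fun _ => Finset.card_filter_le _ _,
    fun _ => Finset.card_filter_le _ _⟩
  · refine Finset.card_lt_card (Finset.ssubset_iff_of_subset ?_ |>.2 ⟨a, by simp [ha, h], by simp⟩)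
    exact Finset.monotone_filter_right _ fun x _ hx => lt_trans hx h
  · contrapose! h
    exact Finset.card_le_card (Finset.monotone_filter_right _ fun x _ hx => lt_of_lt_of_le hx h)

theorem le (f : α → L) (g : β → L) : IsRankable fun a b => f a ≤ g b := by
  intro A
  refine ⟨fun a => (A.filter (f · < f a)).card, fun b => (A.filter (f · ≤ g b)).card,
    fun a ha b => ⟨fun h => ?_, fun h => ?_⟩, fun _ => Finset.card_filter_le _ _,
    fun _ => Finset.card_filter_le _ _⟩
  · refine Finset.card_lt_card (Finset.ssubset_iff_of_subset ?_ |>.2 ⟨a, by simp [ha, h], by simp⟩)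
    exact Finset.monotone_filter_right _ fun x _ hx => hx.le.trans h
  · contrapose! h
    exact Finset.card_le_card (Finset.monotone_filter_right _ fun x _ hx => lt_of_le_of_lt hx h)

end IsRankable

namespace HasLinearFactorization

variable {N c : ℕ} {Q R : α → β → Prop}

theorem mono (h : HasLinearFactorization N Q c) {d : ℕ} (hcd : c ≤ d) :
    HasLinearFactorization N Q d := fun A B hN => (h A B hN).mono (by gcongr)

theorem congr (h : HasLinearFactorization N Q c) (hQR : ∀ a b, R a b ↔ Q a b) :
    HasLinearFactorization N R c := fun A B hN => (h A B hN).congr fun a _ b _ => hQR a b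

theorem of_true : HasLinearFactorization N (fun (_ : α) (_ : β) => True) 2 := by
  intro A B _
  rcases A.eq_empty_or_nonempty with rfl | hA
  · exact .of_forall_not _ (by simp)
  · refine (HasFactorization.of_buckets A B (fun _ => ()) (fun _ => ()) fun _ _ => True).mono ?_
    have := hA.card_pos
    simp
    omega

theorem or_of_disjoint {P : α → β → Prop} {d : ℕ} (hP : HasLinearFactorization N P c)
    (hQ : HasLinearFactorization N Q d) (hdisj : ∀ a b, ¬ (P a b ∧ Q a b))
    (hR : ∀ a b, R a b ↔ P a b ∨ Q a b) : HasLinearFactorization N R (c + d) := by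
  intro A B hN
  rw [add_mul]
  exact (hP A B hN).or_of_disjoint (hQ A B hN) (fun a _ b _ => hdisj a b) fun a _ b _ => hR a b

theorem and_eq (h : HasLinearFactorization N Q c) {γ : Type*} (u : α → γ) (v : β → γ) :
    HasLinearFactorization N (fun a b => Q a b ∧ u a = v b) c := by
  classical
  intro A B hN
  have hle (i : γ) : (A.filter (u · = i)).card + (B.filter (v · = i)).card ≤ A.card + B.card :=
    add_le_add (Finset.card_filter_le _ _) (Finset.card_filter_le _ _)
  refine (HasFactorization.and_eq_of_classes (S := A.image u ∪ B.image v) (fun a ha => ?_)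
    fun i _ => h _ _ ((hle i).trans hN)).mono ?_
  · exact Finset.mem_union_left _ (Finset.mem_image_of_mem u ha)
  · rw [← Finset.mul_sum, Finset.sum_add_distrib,
      ← Finset.card_eq_sum_card_fiberwise (f := u) (s := A),
      ← Finset.card_eq_sum_card_fiberwise (f := v) (s := B)]
    · exact fun b hb => Finset.mem_union_right _ (Finset.mem_image_of_mem v hb)
    · exact fun a ha => Finset.mem_union_left _ (Finset.mem_image_of_mem u ha)

theorem restrict (h : HasLinearFactorization N Q c) (p : α → Prop) (q : β → Prop) :
    HasLinearFactorization N (fun a b => Q a b ∧ p a ∧ q b) c :=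
  ((h.and_eq p fun _ => True).and_eq (fun _ => True) q).congr fun a b => by simp; tauto

theorem and_lt_of_lt_two_pow (h : HasLinearFactorization N Q c) (e : ℕ) :
    ∀ (f : α → ℕ) (g : β → ℕ), (∀ a, f a < 2 ^ e) → (∀ b, g b < 2 ^ e) →
      HasLinearFactorization N (fun a b => Q a b ∧ f a < g b) (c * e) := by
  induction e with
  | zero =>
    intro f g hf hg A B _
    refine .of_forall_not _ fun a _ b _ hab => ?_
    have := hg b
    omega
  | succ e ih =>
    intro f g hf hg
    have hhigh := ih (f · / 2) (g · / 2)
      (fun a => Nat.div_lt_of_lt_mul (by rw [← pow_succ']; exact hf a))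
      (fun b => Nat.div_lt_of_lt_mul (by rw [← pow_succ']; exact hg b))
    have hlow := (h.and_eq (f · / 2) (g · / 2)).restrict (f · % 2 = 0) (g · % 2 = 1)
    refine hhigh.or_of_disjoint hlow (fun a b hab => hab.1.2.ne hab.2.1.2) fun a b => ?_
    by_cases hQ : Q a b <;> simp [hQ]
    omega

theorem and_of_isRankable (h : HasLinearFactorization N Q c) (hR : IsRankable R) {e : ℕ}
    (he : N < 2 ^ e) : HasLinearFactorization N (fun a b => Q a b ∧ R a b) (c * e) := by
  intro A B hN
  obtain ⟨f, g, hR, hf, hg⟩ := hR A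
  have hA : A.card < 2 ^ e := by omega
  refine ((h.and_lt_of_lt_two_pow e f g (fun a => (hf a).trans_lt hA)
    fun b => (hg b).trans_lt hA) A B hN).congr fun a ha b _ => ?_
  rw [hR a ha b]

theorem of_isRankable (hR : IsRankable R) {e k : ℕ} (he : N < 2 ^ e) (hk : e ≤ 2 ^ k) :
    HasLinearFactorization N R (3 * (k + 2)) := by
  intro A B hN
  obtain ⟨f, g, hR, hf, hg⟩ := hR A
  rcases A.eq_empty_or_nonempty with rfl | hA
  · exact .of_forall_not _ (by simp)
  set d := Nat.log 2 A.card + 1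
  have hlt : A.card < 2 ^ d := Nat.lt_pow_succ_log_self (by norm_num) _
  have hle : 2 ^ d ≤ 2 * A.card := by
    rw [pow_succ']
    exact Nat.mul_le_mul_left _ (Nat.pow_log_le_self 2 hA.card_ne_zero)
  have hde : d ≤ e := Nat.log_lt_of_lt_pow hA.card_ne_zero (by omega)
  refine ((HasFactorization.lt_of_lt_two_pow k d (hde.trans hk) A B f g
    (fun a _ => (hf a).trans_lt hlt) fun b _ => (hg b).trans_lt hlt).congr
    fun a ha b _ => hR a ha b).mono ?_
  calc (k + 2) * (A.card + B.card + 2 ^ d) ≤ (k + 2) * (3 * (A.card + B.card)) := by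
        gcongr; omega
    _ = _ := by ring

variable {m : ℕ} {Q : (Fin m → ℝ) → (Fin m → ℝ) → Prop}

/-- Every non-equality atom splits into at most three disjoint relations, each a conjunction of
an equality of keys and a rankable relation. -/
theorem and_joinAtom (hQ : HasLinearFactorization N Q c)
    (hrank : ∀ R, IsRankable R → HasLinearFactorization N (fun a b => Q a b ∧ R a b) c)
    (atom : JoinAtom m) (hband : ∀ j j' ε, atom = .band j j' ε → 0 < ε) :
    HasLinearFactorization N (fun a b => Q a b ∧ atom.eval a b) (3 * c) := by
  cases atom with
  | lt j j' => exact (hrank _ (.lt (· j) (· j'))).mono (d := 3 * c) (by omega)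
  | le j j' => exact (hrank _ (.le (· j) (· j'))).mono (d := 3 * c) (by omega)
  | gt j j' =>
    exact ((hrank _ (.lt (-· j) (-· j'))).mono (d := 3 * c) (by omega)).congr
      fun a b => by simp [JoinAtom.eval]
  | ge j j' =>
    exact ((hrank _ (.le (-· j) (-· j'))).mono (d := 3 * c) (by omega)).congr
      fun a b => by simp [JoinAtom.eval]
  | eq j j' => exact (hQ.and_eq (· j) (· j')).mono (by omega)
  | ne j j' =>
    refine ((hrank _ (.lt (· j) (· j'))).or_of_disjoint (hrank _ (.lt (-· j) (-· j')))
      (R := fun a b => Q a b ∧ a j ≠ b j') (fun a b h => ?_) fun a b => ?_).mono (by omega)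
    · linarith [h.1.2, h.2.2]
    · rw [← and_or_left, neg_lt_neg_iff, lt_or_lt_iff_ne]
  | band j j' ε =>
    have hε := hband _ _ _ rfl
    have hsame := hQ.and_eq (fun a => ⌊a j / ε⌋) fun b => ⌊b j' / ε⌋
    have hnext := (hrank _ (.lt (fun a => -(a j / ε)) fun b => 1 - b j' / ε)).and_eq
      (fun a => ⌊a j / ε⌋ + 1) fun b => ⌊b j' / ε⌋
    have hprev := (hrank _ (.lt (fun a => a j / ε) fun b => b j' / ε + 1)).and_eq
      (fun a => ⌊a j / ε⌋) fun b => ⌊b j' / ε⌋ + 1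
    refine ((hsame.or_of_disjoint (hnext.or_of_disjoint hprev (fun a b h => ?_) fun a b => Iff.rfl)
      (fun a b h => ?_)) fun a b => ?_).mono (d := 3 * c) (by omega)
    · have h1 := h.1.2
      have h2 := h.2.2
      omega
    · rcases h with ⟨⟨_, h1⟩, ⟨_, h2⟩ | ⟨_, h2⟩⟩ <;> omega
    · have heval : JoinAtom.eval (.band j j' ε) a b ↔ |a j / ε - b j' / ε| < 1 := by
        rw [← sub_div, abs_div, abs_of_pos hε, div_lt_one hε, JoinAtom.eval]
      rw [heval, abs_sub_lt_one_iff_floor]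
      tauto

/-- Equality atoms do not increase the size of a factorization. -/
theorem and_forall_isEq (l : List (JoinAtom m)) (hl : ∀ atom ∈ l, atom.isEq = true)
    (hQ : HasLinearFactorization N Q c) :
    HasLinearFactorization N (fun a b => Q a b ∧ ∀ atom ∈ l, atom.eval a b) c := by
  induction l generalizing Q with
  | nil => simpa using hQ
  | cons atom l ih =>
    rw [List.forall_mem_cons] at hl
    cases atom with
    | eq j j' =>
      exact (ih hl.2 (hQ.and_eq (· j) (· j'))).congr fun a b => by
        rw [List.forall_mem_cons, and_assoc]; rfl
    | _ => simp [JoinAtom.isEq] at hl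

/-- The first non-equality atom of a conjunction is factorized through blocks, every further one
multiplies the size by at most `3 * e`. -/
theorem of_conjunction {e k : ℕ} (he : N < 2 ^ e) (he0 : e ≠ 0) (hk : e ≤ 2 ^ k)
    (l : List (JoinAtom m)) (hband : ∀ atom ∈ l, ∀ j j' ε, atom = .band j j' ε → 0 < ε) :
    HasLinearFactorization N (fun a b => ∀ atom ∈ l, atom.eval a b)
      (3 ^ ((l.filter fun atom => !atom.isEq).length + 1) * (k + 2) *
        e ^ ((l.filter fun atom => !atom.isEq).length - 1)) := by
  induction l with
  | nil =>
    exact (of_true.congr fun a b => by simp).mono (by simp; omega)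
  | cons atom l ih =>
    rw [List.forall_mem_cons] at hband
    specialize ih hband.2
    by_cases heq : atom.isEq = true
    · rw [List.filter_cons_of_neg (by simp [heq])]
      cases atom with
      | eq j j' =>
        exact (ih.and_eq (· j) (· j')).congr fun a b => by
          rw [List.forall_mem_cons, and_comm]; rfl
      | _ => simp [JoinAtom.isEq] at heq
    · rw [List.filter_cons_of_pos (by simp [heq]), List.length_cons]
      generalize hq : (l.filter fun atom => !atom.isEq).length = q at ih
      cases q with
      | zero =>
        have hl : ∀ atom ∈ l, atom.isEq = true := by
          simpa [List.filter_eq_nil_iff] using hq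
        have hatom := and_joinAtom (of_true.mono (d := 3 * (k + 2)) (by omega))
          (fun R hR => (of_isRankable hR he hk).congr fun a b => by rw [true_and]) atom hband.1
        refine ((hatom.and_forall_isEq l hl).congr fun a b => ?_).mono (le_of_eq (by ring))
        rw [List.forall_mem_cons, true_and]
      | succ q =>
        have hatom := and_joinAtom (ih.mono (Nat.le_mul_of_pos_right _ (Nat.pos_of_ne_zero he0)))
          (fun R hR => ih.and_of_isRankable hR he) atom hband.1
        refine (hatom.congr fun a b => ?_).mono (le_of_eq ?_)
        · rw [List.forall_mem_cons, and_comm]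
        · simp only [Nat.add_sub_cancel]
          ring

end HasLinearFactorization
end Factorization

section Transfer

variable {α β : Type*}

open Classical in
theorem witnessCount_eq_pathCount {x y : ℕ} (E1 : Finset (α × Fin x)) (E2 : Finset (Fin x × Fin y))
    (E3 : Finset (Fin y × β)) (a : α) (b : β) :
    witnessCount E1 E2 E3 a b = pathCount E1 E2 E3 a b := by
  rw [witnessCount, pathCount, Nat.card_eq_fintype_card, Fintype.card_subtype, Finset.card_filter,
    Fintype.sum_prod_type]
  congr!

theorem witnessCount_pos_iff {x y : ℕ} (E1 : Finset (α × Fin x)) (E2 : Finset (Fin x × Fin y))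
    (E3 : Finset (Fin y × β)) (a : α) (b : β) :
    0 < witnessCount E1 E2 E3 a b ↔ ∃ i j, (a, i) ∈ E1 ∧ (i, j) ∈ E2 ∧ (j, b) ∈ E3 := by
  rw [witnessCount, Nat.card_pos_iff]
  simp [Subtype.finite]

/-- A factorization of `μ` may be taken over layers `Fin x`, `Fin y` and with end points in given
sets `A` and `B`. -/
theorem HasFactorization.exists_fin {μ : α → β → ℕ} {s : ℕ} (h : HasFactorization μ s)
    (A : Finset α) (B : Finset β) :
    ∃ (x y : ℕ) (E1 : Finset (α × Fin x)) (E2 : Finset (Fin x × Fin y)) (E3 : Finset (Fin y × β)),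
      E1.card + E2.card + E3.card ≤ s ∧ (∀ e ∈ E1, e.1 ∈ A) ∧ (∀ e ∈ E3, e.2 ∈ B) ∧
        ∀ a ∈ A, ∀ b ∈ B, witnessCount E1 E2 E3 a b = μ a b := by
  classical
  obtain ⟨X, Y, _, _, E1, E2, E3, hs, hμ⟩ := h
  let i := Fintype.equivFin X
  let j := Fintype.equivFin Y
  refine ⟨_, _, (E1.filter (·.1 ∈ A)).image (Prod.map id i), E2.image (Prod.map i j),
    (E3.filter (·.2 ∈ B)).image (Prod.map j id), ?_, by aesop, by aesop, fun a ha b hb => ?_⟩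
  · refine le_trans (add_le_add_three ?_ Finset.card_image_le ?_) hs
    · exact Finset.card_image_le.trans (Finset.card_filter_le _ _)
    · exact Finset.card_image_le.trans (Finset.card_filter_le _ _)
  · rw [witnessCount_eq_pathCount, ← hμ, pathCount, pathCount, ← i.sum_comp]
    refine Finset.sum_congr rfl fun x _ => ?_
    rw [← j.sum_comp]
    refine Finset.sum_congr rfl fun y _ => ?_
    simp [ha, hb]

end Transfer

theorem natLog_add_one_le_one_add_logb (n : ℕ) :
    ((Nat.log 2 n + 1 : ℕ) : ℝ) ≤ 1 + Real.logb 2 n := by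
  have := Real.natLog_le_logb n 2
  push_cast at *
  linarith

theorem clog_le_one_add_logb (e : ℕ) : (Nat.clog 2 e : ℝ) ≤ 1 + Real.logb 2 e := by
  have h1 : Nat.clog 2 e ≤ Nat.log 2 e + 1 :=
    Nat.clog_le_of_le_pow (Nat.lt_pow_succ_log_self (by norm_num) e).le
  have h2 := natLog_add_one_le_one_add_logb e
  exact le_trans (by exact_mod_cast h1) h2

/-- Main structural theorem: for a DNF join condition `θ` with `r` disjuncts over
inequality, non-equality, band (with positive width) and equality atoms, with at most
`p ≥ 1` non-equality atoms per disjunct, there is a constant `C` (depending only on `θ`)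
such that for all `A, B ⊆ ℝ^m` with `|A| + |B| = n ≥ 2`, the relation defined by `θ` admits
a depth-3 factorization of size at most
`C · n · (1 + log₂ n)^(p-1) · (1 + log₂(1 + log₂ n))` in which every pair satisfying `θ` has
at least one and at most `r` witnessing pairs. -/
theorem dnf_depth3_factorization (m r p : ℕ) (hp : 1 ≤ p)
    (disjuncts : Fin r → List (JoinAtom m))
    (hband : ∀ i : Fin r, ∀ atom ∈ disjuncts i,
      ∀ (j j' : Fin m) (ε : ℝ), atom = JoinAtom.band j j' ε → 0 < ε)
    (hcount : ∀ i : Fin r, ((disjuncts i).filter fun atom => !atom.isEq).length ≤ p) :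
    ∃ C : ℝ, ∀ (A B : Finset (Fin m → ℝ)) (n : ℕ), A.card + B.card = n → 2 ≤ n →
      ∃ (x y : ℕ) (E1 : Finset ((Fin m → ℝ) × Fin x)) (E2 : Finset (Fin x × Fin y))
        (E3 : Finset (Fin y × (Fin m → ℝ))),
        IsDepth3Fact A B
          (fun a b => ∃ i : Fin r, ∀ atom ∈ disjuncts i, atom.eval a b) E1 E2 E3 ∧
        ((E1.card : ℝ) + (E2.card : ℝ) + (E3.card : ℝ)) ≤
          C * n * (1 + Real.logb 2 n) ^ (p - 1) *
            (1 + Real.logb 2 (1 + Real.logb 2 n)) ∧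
        ∀ a ∈ A, ∀ b ∈ B, (∃ i : Fin r, ∀ atom ∈ disjuncts i, atom.eval a b) →
          1 ≤ witnessCount E1 E2 E3 a b ∧ witnessCount E1 E2 E3 a b ≤ r := by
  classical
  refine ⟨r * 3 ^ (p + 2), fun A B n hn hn2 => ?_⟩
  set e := Nat.log 2 n + 1 with he
  set k := Nat.clog 2 e
  have hconj (i : Fin r) : HasFactorization
      (relIndicator A B fun a b => ∀ atom ∈ disjuncts i, atom.eval a b)
      (3 ^ (p + 1) * (k + 2) * e ^ (p - 1) * n) := by
    have h := (HasLinearFactorization.of_conjunction (Nat.lt_pow_succ_log_self (by norm_num) n)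
      (by omega) (Nat.le_pow_clog (by norm_num) e) (disjuncts i) (hband i)) A B hn.le
    rw [hn] at h
    refine h.mono ?_
    have := hcount i
    gcongr <;> omega
  obtain ⟨x, y, E1, E2, E3, hs, hA, hB, hμ⟩ :=
    (HasFactorization.sum Finset.univ fun i _ => hconj i).exists_fin A B
  have hcard : ∀ a ∈ A, ∀ b ∈ B, witnessCount E1 E2 E3 a b =
      (Finset.univ.filter fun i => ∀ atom ∈ disjuncts i, atom.eval a b).card := by
    intro a ha b hb
    rw [hμ a ha b hb, Finset.card_filter, Finset.sum_apply, Finset.sum_apply]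
    simp [relIndicator, ha, hb]
  have hpos : ∀ a ∈ A, ∀ b ∈ B, (∃ i, ∀ atom ∈ disjuncts i, atom.eval a b) ↔
      0 < witnessCount E1 E2 E3 a b := by
    intro a ha b hb
    rw [hcard a ha b hb, Finset.card_pos]
    simp [Finset.Nonempty]
  refine ⟨x, y, E1, E2, E3, ⟨hA, hB, fun a ha b hb => ?_⟩, ?_, fun a ha b hb h => ⟨?_, ?_⟩⟩
  · exact (hpos a ha b hb).trans (witnessCount_pos_iff E1 E2 E3 a b)
  · rw [Finset.sum_const, Finset.card_univ, Fintype.card_fin, smul_eq_mul] at hs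
    have hs' : ((E1.card : ℝ) + E2.card + E3.card) ≤
        r * (3 ^ (p + 1) * (k + 2) * e ^ (p - 1) * n) := by exact_mod_cast hs
    have he_le : (e : ℝ) ≤ 1 + Real.logb 2 n := natLog_add_one_le_one_add_logb n
    have he_pos : (1 : ℝ) ≤ e := by exact_mod_cast Nat.le_add_left 1 _
    have hk_le : (k : ℝ) ≤ 1 + Real.logb 2 (1 + Real.logb 2 n) :=
      (clog_le_one_add_logb e).trans (by gcongr; norm_num)
    have hlog : 0 ≤ Real.logb 2 (1 + Real.logb 2 n) :=
      Real.logb_nonneg (by norm_num) (he_pos.trans he_le)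
    have hk3 : (k : ℝ) + 2 ≤ 3 * (1 + Real.logb 2 (1 + Real.logb 2 n)) := by linarith
    refine hs'.trans ?_
    calc (r : ℝ) * (3 ^ (p + 1) * (k + 2) * e ^ (p - 1) * n)
        ≤ r * (3 ^ (p + 1) * (3 * (1 + Real.logb 2 (1 + Real.logb 2 n))) *
          (1 + Real.logb 2 n) ^ (p - 1) * n) := by gcongr
      _ = _ := by ring
  · exact (hpos a ha b hb).1 h
  · rw [hcard a ha b hb]
    exact (Finset.card_le_univ _).trans_eq (Fintype.card_fin r)
end
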